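/- There exist C > 0 and λ₀ > 0, depending only on the curve c, such that for every λ ≥ λ₀ and every function φ : ℝ² → ℝ which is C^∞ on an open neighborhood of the closure of D and satisfies Δφ(x) = −λ²φ(x) for all x in that neighborhood, one has ∫_D φ(x)² dx ≤ C · λ · ( ∫₀^L φ(c(s))² ds + ∫₀^L ⟨∇φ(c(s)), n(s)⟩² ds ). -/

import Mathlib

open MeasureTheory Real
open scoped RealInnerProductSpace

noncomputable section

abbrev E2 : Type := EuclideanSpace ℝ (Fin 2)

/-- The Euclidean Laplacian `∂²/∂x₁² + ∂²/∂x₂²` on `ℝ²`. -/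
def lap (φ : E2 → ℝ) (x : E2) : ℝ :=
  ∑ i : Fin 2,
    fderiv ℝ (fun y => fderiv ℝ φ y (EuclideanSpace.single i 1)) x (EuclideanSpace.single i 1)

/-- A bounded open connected planar domain. -/
structure IsPlaneDomain (D : Set E2) : Prop where
  isOpen : IsOpen D
  isBounded : Bornology.IsBounded D
  isConnected : IsConnected D

/-- An arc-length parametrization `c` of the boundary of `D`: a simple closed real-analytic
curve, periodic with period `len`, injective on `[0, len)`, unit speed, with image equal to
the frontier of `D`, together with a unit normal `n` along the curve. -/
structure AnalyticBoundaryCurve (D : Set E2) where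
  len : ℝ
  len_pos : 0 < len
  c : ℝ → E2
  cd : ℝ → E2
  hasDerivAt : ∀ s, HasDerivAt c (cd s) s
  analytic : AnalyticOnNhd ℝ c Set.univ
  periodic : Function.Periodic c len
  injOn : Set.InjOn c (Set.Ico 0 len)
  unitSpeed : ∀ s, ‖cd s‖ = 1
  range_eq : Set.range c = frontier D
  n : ℝ → E2
  n_unit : ∀ s, ‖n s‖ = 1
  n_orth : ∀ s, ⟪n s, cd s⟫ = 0

open Set Filter Topology
open scoped ContDiff

/-- The partial derivative `∂f/∂xᵢ` on `ℝ²`. -/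
def pd (i : Fin 2) (f : E2 → ℝ) (x : E2) : ℝ :=
  fderiv ℝ f x (EuclideanSpace.single i 1)

lemma lap_eq (f : E2 → ℝ) (x : E2) : lap f x = pd 0 (pd 0 f) x + pd 1 (pd 1 f) x := by
  simp [lap, pd, Fin.sum_univ_two]
  rfl

lemma ContDiff.pd {f : E2 → ℝ} (hf : ContDiff ℝ ∞ f) (i : Fin 2) : ContDiff ℝ ∞ (pd i f) :=
  (hf.fderiv_right (m := ∞) (by simp)).clm_apply contDiff_const

lemma ContDiff.differentiableAt_top {f : E2 → ℝ} (hf : ContDiff ℝ ∞ f) (x : E2) :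
    DifferentiableAt ℝ f x :=
  hf.contDiffAt.differentiableAt (by simp)

lemma pd_add {f g : E2 → ℝ} {x : E2} (hf : DifferentiableAt ℝ f x) (hg : DifferentiableAt ℝ g x)
    (i : Fin 2) : pd i (fun y => f y + g y) x = pd i f x + pd i g x := by
  simp [pd, fderiv_fun_add hf hg]

lemma pd_sub {f g : E2 → ℝ} {x : E2} (hf : DifferentiableAt ℝ f x) (hg : DifferentiableAt ℝ g x)
    (i : Fin 2) : pd i (fun y => f y - g y) x = pd i f x - pd i g x := by
  simp [pd, fderiv_fun_sub hf hg]

lemma pd_mul {f g : E2 → ℝ} {x : E2} (hf : DifferentiableAt ℝ f x) (hg : DifferentiableAt ℝ g x)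
    (i : Fin 2) : pd i (fun y => f y * g y) x = f x * pd i g x + pd i f x * g x := by
  simp [pd, fderiv_fun_mul hf hg, mul_comm]

lemma pd_sq {f : E2 → ℝ} {x : E2} (hf : DifferentiableAt ℝ f x)
    (i : Fin 2) : pd i (fun y => f y ^ 2) x = 2 * f x * pd i f x := by
  simp only [pow_two, pd_mul hf hf]; ring

lemma pd_const_mul {f : E2 → ℝ} {x : E2} (a : ℝ) (hf : DifferentiableAt ℝ f x)
    (i : Fin 2) : pd i (fun y => a * f y) x = a * pd i f x := by
  simp [pd, fderiv_const_mul hf]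

lemma pd_coord (i j : Fin 2) (x : E2) : pd i (fun y : E2 => y j) x = if j = i then 1 else 0 := by
  have : HasFDerivAt (fun y : E2 => y j) (EuclideanSpace.proj j : E2 →L[ℝ] ℝ) x :=
    (EuclideanSpace.proj j : E2 →L[ℝ] ℝ).hasFDerivAt
  simp [pd, this.fderiv]

lemma pd_congr {f g : E2 → ℝ} {x : E2} (h : f =ᶠ[𝓝 x] g) (i : Fin 2) : pd i f x = pd i g x := by
  simp [pd, h.fderiv_eq]

lemma pd_comm {f : E2 → ℝ} (hf : ContDiff ℝ ∞ f) (i j : Fin 2) (x : E2) :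
    pd i (pd j f) x = pd j (pd i f) x := by
  have h : IsSymmSndFDerivAt ℝ f x := hf.contDiffAt.isSymmSndFDerivAt (by
    rw [minSmoothness_of_isRCLikeNormedField]; exact WithTop.coe_le_coe.2 le_top)
  have hd : DifferentiableAt ℝ (fderiv ℝ f) x :=
    (hf.fderiv_right (m := ∞) (by simp)).contDiffAt.differentiableAt (by simp)
  have key : ∀ i j : Fin 2, pd i (pd j f) x =
      fderiv ℝ (fderiv ℝ f) x (EuclideanSpace.single i 1) (EuclideanSpace.single j 1) := by
    intro i j
    change fderiv ℝ (fun y => fderiv ℝ f y (EuclideanSpace.single j 1)) x _ = _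
    rw [fderiv_clm_apply hd (by fun_prop)]
    simp
  rw [key, key, h.eq]

lemma HasCompactSupport.pd {f : E2 → ℝ} (hf : HasCompactSupport f) (i : Fin 2) :
    HasCompactSupport (pd i f) :=
  hf.fderiv_apply ℝ _

lemma integral_pd_eq_zero {f : E2 → ℝ} (hf : ContDiff ℝ 1 f) (hc : HasCompactSupport f)
    (i : Fin 2) : ∫ x, pd i f x = 0 := by
  have h := integral_mul_fderiv_eq_neg_fderiv_mul_of_integrable (μ := (volume : Measure E2))
    (𝕜 := ℝ) (f := fun _ => (1 : ℝ)) (g := f) (v := EuclideanSpace.single i 1)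
    (by simp) (by
      simp only [one_mul]
      exact ((hf.continuous_fderiv (by simp)).clm_apply
        continuous_const).integrable_of_hasCompactSupport
        (hc.fderiv_apply ℝ _))
    (by simpa using hf.continuous.integrable_of_hasCompactSupport hc)
    (by intro x _; fun_prop) (by intro x _; exact hf.differentiable (by simp) x)
  simpa [_root_.pd] using h

/-- Rellich's estimate: a compactly supported function is controlled by its image under the
Helmholtz operator, with a gain of one power of the frequency. -/
lemma integral_sq_le_of_helmholtz {v : E2 → ℝ} (hv : ContDiff ℝ ∞ v) (hc : HasCompactSupport v)
    {R lam : ℝ} (hlam : 1 ≤ lam) (hR : ∀ x, v x ≠ 0 → ‖x‖ ≤ R) :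
    ∫ x, v x ^ 2 ≤ 2 * (1 + R ^ 2) / lam ^ 2 * ∫ x, (lap v x + lam ^ 2 * v x) ^ 2 := by
  have hp : ∀ i, ContDiff ℝ ∞ (pd i v) := hv.pd
  have hpc : ∀ i, HasCompactSupport (pd i v) := hc.pd
  have hx : ∀ i : Fin 2, ContDiff ℝ ∞ (fun x : E2 => x i) := fun i => by fun_prop
  -- the radial derivative and the squared gradient
  set E : E2 → ℝ := fun x => x 0 * pd 0 v x + x 1 * pd 1 v x with hE
  have hEs : ContDiff ℝ ∞ E := ((hx 0).mul (hp 0)).add ((hx 1).mul (hp 1))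
  set G : E2 → ℝ := fun x => pd 0 v x ^ 2 + pd 1 v x ^ 2 with hG
  have hGs : ContDiff ℝ ∞ G := ((hp 0).pow 2).add ((hp 1).pow 2)
  set F : Fin 2 → E2 → ℝ := fun i x =>
    E x * pd i v x - x i * (2⁻¹ * G x) + lam ^ 2 * (2⁻¹ * (x i * v x ^ 2))
      + 4⁻¹ * (v x * pd i v x) with hF
  have hFs : ∀ i, ContDiff ℝ ∞ (F i) := fun i =>
    (((hEs.mul (hp i)).sub ((hx i).mul (contDiff_const.mul hGs))).add
      (contDiff_const.mul (contDiff_const.mul ((hx i).mul (hv.pow 2))))).add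
      (contDiff_const.mul (hv.mul (hp i)))
  have hFc : ∀ i, HasCompactSupport (F i) := by
    intro i
    have h0 : ∀ j, pd j v =ᶠ[coclosedCompact E2] 0 := fun j =>
      hasCompactSupport_iff_eventuallyEq.1 (hpc j)
    have h1 := hasCompactSupport_iff_eventuallyEq.1 hc
    rw [hasCompactSupport_iff_eventuallyEq]
    filter_upwards [h0 0, h0 1, h0 i, h1] with x h0 h1 h2 h3
    simp at h0 h1 h2 h3
    simp [hF, hG, h0, h1, h2, h3]
  have hdivF : ∀ x, pd 0 (F 0) x + pd 1 (F 1) x =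
      E x * (lap v x + lam ^ 2 * v x) + lam ^ 2 * v x ^ 2 + 4⁻¹ * (G x + v x * lap v x) := by
    intro x
    have dE := hEs.differentiableAt_top x
    have dG := hGs.differentiableAt_top x
    have dv := hv.differentiableAt_top x
    have dp := fun i => (hp i).differentiableAt_top x
    have dx := fun i => (hx i).differentiableAt_top x
    have eF : ∀ i, pd i (F i) x = (E x * pd i (pd i v) x + pd i E x * pd i v x)
        - (x i * (2⁻¹ * pd i G x) + 2⁻¹ * G x)
        + lam ^ 2 * (2⁻¹ * (x i * (2 * v x * pd i v x) + v x ^ 2))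
        + 4⁻¹ * (v x * pd i (pd i v) x + pd i v x * pd i v x) := by
      intro i
      have d2 : DifferentiableAt ℝ (fun y => v y ^ 2) x := dv.pow 2
      have d3 : DifferentiableAt ℝ (fun y : E2 => y i * v y ^ 2) x := (dx i).mul d2
      simp only [hF]
      rw [pd_add (((dE.fun_mul (dp i)).fun_sub ((dx i).fun_mul (dG.const_mul _))).fun_add
          ((d3.const_mul _).const_mul _)) ((dv.fun_mul (dp i)).const_mul _),
        pd_add ((dE.fun_mul (dp i)).fun_sub ((dx i).fun_mul (dG.const_mul _)))
          ((d3.const_mul _).const_mul _),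
        pd_sub (dE.fun_mul (dp i)) ((dx i).fun_mul (dG.const_mul _)),
        pd_mul dE (dp i), pd_mul (dx i) (dG.const_mul _), pd_const_mul _ dG,
        pd_const_mul _ (d3.const_mul _), pd_const_mul _ d3, pd_mul (dx i) d2, pd_sq dv,
        pd_const_mul _ (dv.fun_mul (dp i)), pd_mul dv (dp i)]
      simp only [pd_coord, if_true]
      ring
    have eE : ∀ i, pd i E x = (x 0 * pd i (pd 0 v) x + (if 0 = i then 1 else 0) * pd 0 v x)
        + (x 1 * pd i (pd 1 v) x + (if 1 = i then 1 else 0) * pd 1 v x) := by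
      intro i
      simp only [hE]
      rw [pd_add ((dx 0).fun_mul (dp 0)) ((dx 1).fun_mul (dp 1)), pd_mul (dx 0) (dp 0),
        pd_mul (dx 1) (dp 1), pd_coord, pd_coord]
    have eG : ∀ i, pd i G x = 2 * pd 0 v x * pd i (pd 0 v) x + 2 * pd 1 v x * pd i (pd 1 v) x := by
      intro i
      simp only [hG]
      rw [pd_add ((dp 0).fun_pow 2) ((dp 1).fun_pow 2), pd_sq (dp 0), pd_sq (dp 1)]
    rw [eF, eF, eE, eE, eG, eG, lap_eq, pd_comm hv 1 0 x]
    simp [hG, hE]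
    ring
  have hls : ContDiff ℝ ∞ (lap v) := by
    rw [show lap v = fun x => pd 0 (pd 0 v) x + pd 1 (pd 1 v) x from funext (lap_eq v)]
    exact ((hp 0).pd 0).add ((hp 1).pd 1)
  have hlc : HasCompactSupport (lap v) := by
    rw [show lap v = fun x => pd 0 (pd 0 v) x + pd 1 (pd 1 v) x from funext (lap_eq v)]
    exact ((hpc 0).pd 0).add ((hpc 1).pd 1)
  set g : E2 → ℝ := fun x => lap v x + lam ^ 2 * v x with hg
  have hgs : ContDiff ℝ ∞ g := hls.add (contDiff_const.mul hv)
  have hgc : HasCompactSupport g := hlc.add hc.mul_left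
  have iv : Integrable (fun x => v x ^ 2) :=
    (hv.continuous.pow 2).integrable_of_hasCompactSupport (by
      simpa only [pow_two] using hc.mul_left (f' := v))
  have ig : Integrable (fun x => g x ^ 2) :=
    (hgs.continuous.pow 2).integrable_of_hasCompactSupport (by
      simpa only [pow_two] using hgc.mul_left (f' := g))
  have iF : ∀ i, Integrable (pd i (F i)) := fun i =>
    ((hFs i).pd i).continuous.integrable_of_hasCompactSupport ((hFc i).pd i)
  have hpt : ∀ x, lam ^ 2 * v x ^ 2 ≤ (pd 0 (F 0) x + pd 1 (F 1) x) +
      (3 / 8 * lam ^ 2 * v x ^ 2 + (1 / (8 * lam ^ 2) + R ^ 2) * g x ^ 2) := by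
    intro x
    by_cases hvx : x ∈ tsupport v
    swap
    · have hz : v =ᶠ[𝓝 x] fun _ => 0 := notMem_tsupport_iff_eventuallyEq.1 hvx
      have hFz : ∀ i, F i =ᶠ[𝓝 x] fun _ => 0 := by
        intro i
        filter_upwards [hz.eventuallyEq_nhds] with y hy
        have h1 : ∀ j, pd j v y = 0 := fun j => by rw [pd_congr hy]; simp [pd]
        simp [hF, hG, hE, h1, hy.self_of_nhds]
      rw [pd_congr (hFz 0), pd_congr (hFz 1), hz.self_of_nhds]
      simp [pd]
      positivity
    have hxR : ‖x‖ ≤ R := by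
      have : IsClosed {x : E2 | ‖x‖ ≤ R} := isClosed_le continuous_norm continuous_const
      exact closure_minimal (fun y hy => hR y hy) this hvx
    have hxR2 : x 0 ^ 2 + x 1 ^ 2 ≤ R ^ 2 := by
      have := EuclideanSpace.norm_sq_eq x
      simp [Fin.sum_univ_two] at this
      rw [← this]
      exact pow_le_pow_left₀ (norm_nonneg _) hxR 2
    rw [hdivF]
    have hl : lap v x = g x - lam ^ 2 * v x := by simp [hg]
    rw [hl]
    have h1 : -(E x * g x) ≤ 4⁻¹ * G x + R ^ 2 * g x ^ 2 := by
      have a : -(E x * g x) ≤ 4⁻¹ * G x + (x 0 ^ 2 + x 1 ^ 2) * g x ^ 2 := by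
        simp only [hE, hG]
        nlinarith [sq_nonneg (pd 0 v x / 2 + x 0 * g x), sq_nonneg (pd 1 v x / 2 + x 1 * g x)]
      have := mul_le_mul_of_nonneg_right hxR2 (sq_nonneg (g x))
      linarith
    have h2 : -(4⁻¹ * (v x * g x)) ≤ 1 / 8 * lam ^ 2 * v x ^ 2 + 1 / (8 * lam ^ 2) * g x ^ 2 := by
      have e : 1 / (8 * lam ^ 2) * g x ^ 2 = 1 / 8 * (g x / lam) ^ 2 := by field_simp
      have e' : v x * g x = (lam * v x) * (g x / lam) := by field_simp
      rw [e, e']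
      nlinarith [sq_nonneg (lam * v x + g x / lam)]
    simp only [sub_add_cancel]
    nlinarith [h1, h2]
  have iP : Integrable (fun x => pd 0 (F 0) x + pd 1 (F 1) x) := (iF 0).add (iF 1)
  have iQ : Integrable (fun x =>
      3 / 8 * lam ^ 2 * v x ^ 2 + (1 / (8 * lam ^ 2) + R ^ 2) * g x ^ 2) :=
    (iv.const_mul _).add (ig.const_mul _)
  have hsum := (integral_mono (iv.const_mul (lam ^ 2)) (iP.add iQ) hpt).trans_eq
    (integral_add iP iQ)
  rw [
    integral_add (iF 0) (iF 1), integral_add (iv.const_mul _) (ig.const_mul _),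
    integral_pd_eq_zero ((hFs 0).of_le (by simp)) (hFc 0),
    integral_pd_eq_zero ((hFs 1).of_le (by simp)) (hFc 1), integral_const_mul,
    integral_const_mul, integral_const_mul] at hsum
  have hg0 : 0 ≤ ∫ x, g x ^ 2 := integral_nonneg fun x => sq_nonneg _
  have hl1 : 1 / (8 * lam ^ 2) ≤ 1 / 8 := by
    apply one_div_le_one_div_of_le (by norm_num); nlinarith
  have : lam ^ 2 * ∫ x, v x ^ 2 ≤ 2 * (1 + R ^ 2) * ∫ x, g x ^ 2 := by
    nlinarith [mul_le_mul_of_nonneg_right hl1 hg0, mul_nonneg (sq_nonneg R) hg0]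
  rw [div_mul_eq_mul_div, le_div_iff₀ (by positivity)]
  linarith

lemma sq_setIntegral_abs_le {Y : Type*} [MeasurableSpace Y] {ν : Measure Y} [IsFiniteMeasure ν]
    {s : Set Y} {A : ℝ} (hA : 0 < A) (hs : ν s ≤ ENNReal.ofReal A)
    {f : Y → ℝ} (hf : Measurable f) (hf2 : Integrable (fun y => f y ^ 2) ν) :
    (∫ y in s, |f y| ∂ν) ^ 2 ≤ A * ∫ y in s, f y ^ 2 ∂ν := by
  have i2 : IntegrableOn (fun y => f y ^ 2) s ν := hf2.integrableOn
  have i1 : IntegrableOn (fun y => |f y|) s ν := by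
    have h : Integrable (fun y => 1 + f y ^ 2) ν := (integrable_const _).add hf2
    refine (h.mono' hf.abs.aestronglyMeasurable (.of_forall fun y => ?_)).integrableOn
    rw [Real.norm_eq_abs, abs_abs]
    nlinarith [sq_nonneg (|f y| - 1), sq_abs (f y)]
  set I := ∫ y in s, |f y| ∂ν
  set m := I / A with hm
  have h0 : 0 ≤ ∫ y in s, (|f y| - m) ^ 2 ∂ν := integral_nonneg fun y => sq_nonneg _
  have hc : ∀ c : ℝ, IntegrableOn (fun _ : Y => c) s ν := fun c => integrable_const c
  have e : ∫ y in s, (|f y| - m) ^ 2 ∂ν =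
      ∫ y in s, f y ^ 2 ∂ν - 2 * m * I + m ^ 2 * ν.real s := by
    have : ∀ y, (|f y| - m) ^ 2 = f y ^ 2 - 2 * m * |f y| + m ^ 2 := fun y => by
      rw [← sq_abs (f y)]; ring
    simp_rw [this]
    have i3 : IntegrableOn (fun y => f y ^ 2 - 2 * m * |f y|) s ν := i2.sub (i1.const_mul _)
    rw [integral_add i3 (hc _), integral_sub i2 (i1.const_mul _), integral_const_mul]
    simp [mul_comm]
    exact Or.inl rfl
  have hν : ν.real s ≤ A := ENNReal.toReal_le_of_le_ofReal hA.le hs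
  rw [e] at h0
  have hmA : m * A = I := by rw [hm]; field_simp
  have h1 : m ^ 2 * ν.real s ≤ m ^ 2 * A := mul_le_mul_of_nonneg_left hν (sq_nonneg _)
  have h2 : m ^ 2 * A = m * I := by rw [← hmA]; ring
  have h3 : m * I ≤ ∫ y in s, f y ^ 2 ∂ν := by linarith
  calc I ^ 2 = A * (m * I) := by rw [← hmA]; ring
    _ ≤ _ := mul_le_mul_of_nonneg_left h3 hA.le

/-- Schur's test on `L²` for the operator whose kernel is the indicator function of a set. -/
lemma integral_sq_setIntegral_le {X Y : Type*} [MeasurableSpace X] [MeasurableSpace Y]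
    (μ : Measure X) [SFinite μ] (ν : Measure Y) [IsFiniteMeasure ν] {S : Set (X × Y)}
    (hS : MeasurableSet S) {A B : ℝ} (hA : 0 < A) (hB : 0 < B)
    (hSA : ∀ x, ν {y | (x, y) ∈ S} ≤ ENNReal.ofReal A)
    (hSB : ∀ y, μ {x | (x, y) ∈ S} ≤ ENNReal.ofReal B)
    {f : Y → ℝ} (hf : Measurable f) (hf2 : Integrable (fun y => f y ^ 2) ν) :
    Integrable (fun x => (∫ y in {y | (x, y) ∈ S}, |f y| ∂ν) ^ 2) μ ∧
      ∫ x, (∫ y in {y | (x, y) ∈ S}, |f y| ∂ν) ^ 2 ∂μ ≤ A * B * ∫ y, f y ^ 2 ∂ν := by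
  have mx : ∀ x, MeasurableSet {y | (x, y) ∈ S} := fun x => measurable_prodMk_left hS
  have my : ∀ y, MeasurableSet {x | (x, y) ∈ S} := fun y => measurable_prodMk_right hS
  set k : X × Y → ℝ := S.indicator fun p => f p.2 ^ 2 with hk
  have mk : Measurable k := ((hf.comp measurable_snd).pow_const 2).indicator hS
  have k0 : ∀ p, 0 ≤ k p := fun p => indicator_nonneg (fun _ _ => sq_nonneg _) p
  have ky : ∀ y, (fun x => k (x, y)) = {x | (x, y) ∈ S}.indicator fun _ => f y ^ 2 := by
    intro y; ext x; simp [hk, indicator]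
  have kx : ∀ x, (fun y => k (x, y)) = {y | (x, y) ∈ S}.indicator fun y => f y ^ 2 := by
    intro x; ext y; simp [hk, indicator]
  have fy : ∀ y, μ.real {x | (x, y) ∈ S} ≤ B := fun y =>
    ENNReal.toReal_le_of_le_ofReal hB.le (hSB y)
  have iy : ∀ y, ∫ x, k (x, y) ∂μ = μ.real {x | (x, y) ∈ S} * f y ^ 2 := by
    intro y
    rw [ky, integral_indicator (my y)]
    simp
  have ik : Integrable k (μ.prod ν) := by
    rw [integrable_prod_iff' mk.aestronglyMeasurable]
    refine ⟨.of_forall fun y => ?_, ?_⟩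
    · rw [ky, integrable_indicator_iff (my y)]
      exact integrableOn_const ((hSB y).trans_lt ENNReal.ofReal_lt_top).ne
    · simp_rw [Real.norm_of_nonneg (k0 _)]
      refine (hf2.const_mul B).mono' ?_ (.of_forall fun y => ?_)
      · exact mk.stronglyMeasurable.integral_prod_left'.aestronglyMeasurable
      · rw [iy, Real.norm_of_nonneg (by positivity)]
        exact mul_le_mul_of_nonneg_right (fy y) (sq_nonneg _)
  have hle : ∀ x, (∫ y in {y | (x, y) ∈ S}, |f y| ∂ν) ^ 2 ≤ A * ∫ y, k (x, y) ∂ν := by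
    intro x
    rw [kx, integral_indicator (mx x)]
    exact sq_setIntegral_abs_le hA (hSA x) hf hf2
  have ik' : Integrable (fun x => A * ∫ y, k (x, y) ∂ν) μ := ik.integral_prod_left.const_mul A
  have int : Integrable (fun x => (∫ y in {y | (x, y) ∈ S}, |f y| ∂ν) ^ 2) μ := by
    refine ik'.mono' ?_ (.of_forall fun x => ?_)
    · have : Measurable fun p : X × Y => S.indicator (fun p => |f p.2|) p :=
        (hf.comp measurable_snd).abs.indicator hS
      have h := this.stronglyMeasurable.integral_prod_right' (ν := ν)
      refine (h.measurable.pow_const 2).aestronglyMeasurable.congr (.of_forall fun x => ?_)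
      simp only
      rw [← integral_indicator (mx x)]
      rfl
    · rw [Real.norm_of_nonneg (sq_nonneg _)]
      exact hle x
  refine ⟨int, (integral_mono int ik' hle).trans ?_⟩
  rw [integral_const_mul, integral_integral_swap (f := fun x y => k (x, y)) ik, mul_assoc]
  refine mul_le_mul_of_nonneg_left ?_ hA.le
  rw [← integral_const_mul]
  refine integral_mono ik.integral_prod_right (hf2.const_mul B) fun y => ?_
  simp only [iy]
  exact mul_le_mul_of_nonneg_right (fy y) (sq_nonneg _)

/-- A compact arc of a regular curve meets every disc of radius `t` in a set of parameters of
length `O(t)`. -/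
lemma exists_volume_closedBall_le {c cd : ℝ → E2} (hc : ∀ s, HasStrictDerivAt c (cd s) s)
    (hu : ∀ s, ‖cd s‖ = 1) {K : Set ℝ} (hK : IsCompact K) :
    ∃ A > (0 : ℝ), ∀ (x : E2) (t : ℝ), 0 < t →
      volume (K ∩ {s | ‖x - c s‖ ≤ t}) ≤ ENNReal.ofReal (A * t) := by
  refine hK.induction_on (p := fun K => ∃ A > (0 : ℝ), ∀ (x : E2) (t : ℝ), 0 < t →
      volume (K ∩ {s | ‖x - c s‖ ≤ t}) ≤ ENNReal.ofReal (A * t)) ?_ ?_ ?_ ?_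
  · exact ⟨1, one_pos, by simp⟩
  · rintro s s' hss' ⟨A, hA, h⟩
    exact ⟨A, hA, fun x t ht => (measure_mono (inter_subset_inter_left _ hss')).trans (h x t ht)⟩
  · rintro s s' ⟨A, hA, h⟩ ⟨A', hA', h'⟩
    refine ⟨A + A', by positivity, fun x t ht => ?_⟩
    rw [union_inter_distrib_right, add_mul, ENNReal.ofReal_add (by positivity) (by positivity)]
    exact (measure_union_le _ _).trans (add_le_add (h x t ht) (h' x t ht))
  · intro s _
    have hlo := (hc s).isLittleO.def (c := 1 / 2) (by norm_num)
    rw [nhds_prod_eq] at hlo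
    obtain ⟨V, hV, hVV⟩ := Filter.eventually_prod_self_iff'.1 hlo
    refine ⟨V, mem_nhdsWithin_of_mem_nhds hV, 4, by norm_num, fun x t ht => ?_⟩
    refine (Real.volume_le_diam _).trans ?_
    refine Metric.ediam_le fun a ha b hb => ?_
    rw [edist_dist]
    refine ENNReal.ofReal_le_ofReal ?_
    have h1 := hVV a ha.1 b hb.1
    have h2 : ‖c a - c b‖ ≤ 2 * t := by
      have : c a - c b = (x - c b) - (x - c a) := by abel
      rw [this]
      exact (norm_sub_le _ _).trans (by linarith [ha.2.out, hb.2.out])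
    have h3 : ‖(a - b) • cd s‖ = |a - b| := by rw [norm_smul, hu, mul_one, Real.norm_eq_abs]
    have h4 : ‖(a - b) • cd s‖ ≤ ‖c a - c b‖ + ‖c a - c b - (a - b) • cd s‖ := by
      rw [norm_sub_rev (c a - c b) ((a - b) • cd s)]
      have := norm_add_le (c a - c b) ((a - b) • cd s - (c a - c b))
      rwa [add_sub_cancel] at this
    rw [Real.dist_eq]
    simp only [ContinuousLinearMap.toSpanSingleton_apply, Real.norm_eq_abs] at h1
    rw [h3] at h4
    linarith

lemma pd_comp_smul {f : E2 → ℝ} (hf : ContDiff ℝ ∞ f) (a : ℝ) (i : Fin 2) (x : E2) :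
    pd i (fun y => f (a • y)) x = a * pd i f (a • x) := by
  have h : HasFDerivAt (fun y : E2 => a • y) (a • ContinuousLinearMap.id ℝ E2) x :=
    (hasFDerivAt_id x).const_smul a
  have := ((hf.differentiableAt_top (a • x)).hasFDerivAt.comp x h).fderiv
  simp only [Function.comp_def] at this
  simp [pd, this]

lemma pd_comp_norm_sq {κ : ℝ → ℝ} (hκ : ContDiff ℝ ∞ κ) (i : Fin 2) (x : E2) :
    pd i (fun y => κ (‖y‖ ^ 2)) x = deriv κ (‖x‖ ^ 2) * (2 * x i) := by
  have h1 : HasFDerivAt (fun y : E2 => ‖y‖ ^ 2) (2 • innerSL ℝ x) x :=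
    (hasStrictFDerivAt_norm_sq x).hasFDerivAt
  have h2 : HasDerivAt κ (deriv κ (‖x‖ ^ 2)) (‖x‖ ^ 2) :=
    (hκ.contDiffAt.differentiableAt (by simp)).hasDerivAt
  have := (h2.comp_hasFDerivAt x h1).fderiv
  simp only [Function.comp_def] at this
  simp [pd, this, EuclideanSpace.inner_single_right]

/-- A mollifier `ρ` on the unit disc such that the difference between `ρ` and its rescaling by
`1 / 2` is the divergence of a vector field supported in the unit disc. -/
structure IsMollifierPair (ρ : E2 → ℝ) (K : Fin 2 → E2 → ℝ) : Prop where
  contDiff : ContDiff ℝ ∞ ρ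
  contDiff_field : ∀ i, ContDiff ℝ ∞ (K i)
  nonneg : ∀ x, 0 ≤ ρ x
  integral_eq_one : ∫ x, ρ x = 1
  eq_zero : ∀ x, 1 < ‖x‖ → ρ x = 0
  field_eq_zero : ∀ i x, 1 < ‖x‖ → K i x = 0
  even : ∀ x, ρ (-x) = ρ x
  div_field : ∀ x, pd 0 (K 0) x + pd 1 (K 1) x = ρ x - 4 * ρ ((2 : ℝ) • x)

lemma hasCompactSupport_of_norm {f : E2 → ℝ} {r : ℝ} (h : ∀ x, r < ‖x‖ → f x = 0) :
    HasCompactSupport f :=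
  HasCompactSupport.of_support_subset_isCompact (isCompact_closedBall (0 : E2) r) fun x hx => by
    by_contra hx'
    exact hx (h x (by simpa using hx'))

lemma exists_isMollifierPair : ∃ ρ K, IsMollifierPair ρ K := by
  set q : ℝ → ℝ := fun s => smoothTransition (2 * s - 1) with hq
  have q0 : ∀ s ≤ 1 / 2, q s = 0 := fun s hs => smoothTransition.zero_of_nonpos (by linarith)
  have q1 : ∀ s, 1 ≤ s → q s = 1 := fun s hs => smoothTransition.one_of_one_le (by linarith)
  have qs : ContDiff ℝ ∞ q :=
    smoothTransition.contDiff.comp ((contDiff_const.mul contDiff_id).sub contDiff_const)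
  have qm : Monotone q := fun a b h => smoothTransition.monotone (by linarith)
  have qd : ∀ s, HasDerivAt q (deriv q s) s := fun s =>
    (qs.contDiffAt.differentiableAt (by simp)).hasDerivAt
  have ps : ContDiff ℝ ∞ (deriv q) := by
    have := (contDiff_infty_iff_deriv (f := q)).1 qs
    exact this.2
  have p0 : ∀ s, 0 ≤ deriv q s := fun s => qm.deriv_nonneg
  have p1 : ∀ s, 1 < s → deriv q s = 0 := by
    intro s hs
    have : q =ᶠ[𝓝 s] fun _ => 1 := by
      filter_upwards [lt_mem_nhds hs] with y hy using q1 y hy.le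
    simp [this.deriv_eq]
  set κ : ℝ → ℝ := fun s => (q s - q (4 * s)) / (2 * s) with hκ
  have κs : ContDiff ℝ ∞ κ := by
    rw [contDiff_iff_contDiffAt]
    intro s
    rcases lt_or_ge s (1 / 8) with h | h
    · have : κ =ᶠ[𝓝 s] fun _ => 0 := by
        filter_upwards [gt_mem_nhds h] with y hy
        simp [hκ, q0 y (by linarith), q0 (4 * y) (by linarith)]
      exact contDiffAt_const.congr_of_eventuallyEq this
    · exact ((qs.sub (qs.comp (contDiff_const.mul contDiff_id))).contDiffAt).div
        (contDiff_const.mul contDiff_id).contDiffAt (by simp; linarith)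
  have κ1 : ∀ s, 1 ≤ s → κ s = 0 := fun s hs => by
    simp [hκ, q1 s hs, q1 (4 * s) (by linarith)]
  have sκ : ∀ s, s * κ s = 2⁻¹ * (q s - q (4 * s)) := by
    intro s
    rcases eq_or_ne s 0 with rfl | h
    · simp
    · simp only [hκ]; field_simp
  have κd : ∀ s, κ s + s * deriv κ s = 2⁻¹ * (deriv q s - 4 * deriv q (4 * s)) := by
    intro s
    have h1 : HasDerivAt (fun s => s * κ s) (1 * κ s + s * deriv κ s) s :=
      (hasDerivAt_id s).mul (κs.contDiffAt.differentiableAt (by simp)).hasDerivAt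
    have h2 : HasDerivAt (fun s => 2⁻¹ * (q s - q (4 * s)))
        (2⁻¹ * (deriv q s - deriv q (4 * s) * 4)) s := by
      have h4 : HasDerivAt (fun s : ℝ => 4 * s) 4 s := by
        simpa using (hasDerivAt_id s).const_mul 4
      exact ((qd s).sub ((qd (4 * s)).comp s h4)).const_mul _
    rw [show (fun s => s * κ s) = fun s => 2⁻¹ * (q s - q (4 * s)) from funext sκ] at h1
    linarith [h1.unique h2]
  have ns : ContDiff ℝ ∞ fun x : E2 => ‖x‖ ^ 2 := contDiff_norm_sq ℝ
  have sq1 : ∀ x : E2, 1 < ‖x‖ → 1 < ‖x‖ ^ 2 := fun x hx => one_lt_pow₀ hx two_ne_zero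
  have ρs : ContDiff ℝ ∞ fun x : E2 => deriv q (‖x‖ ^ 2) := ps.comp ns
  have ρc : HasCompactSupport fun x : E2 => deriv q (‖x‖ ^ 2) :=
    hasCompactSupport_of_norm (r := 1) fun x hx => p1 _ (sq1 x hx)
  set M := ∫ x : E2, deriv q (‖x‖ ^ 2) with hM
  have M0 : M ≠ 0 := by
    intro h0
    have hz : ∀ x : E2, deriv q (‖x‖ ^ 2) = 0 := by
      by_contra! hne
      obtain ⟨x, hx⟩ := hne
      exact (ρs.continuous.integral_pos_of_hasCompactSupport_nonneg_nonzero ρc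
        (fun x => p0 _) hx).ne' h0
    have hz' : ∀ s, deriv q s = 0 := by
      intro s
      rcases lt_or_ge s 0 with hs | hs
      · have : q =ᶠ[𝓝 s] fun _ => 0 := by
          filter_upwards [gt_mem_nhds hs] with y hy using q0 y (by linarith)
        simp [this.deriv_eq]
      · have := hz (EuclideanSpace.single 0 (√s))
        simpa [Real.sq_sqrt hs] using this
    have := is_const_of_deriv_eq_zero (fun s => (qd s).differentiableAt) hz' 0 1
    rw [q0 0 (by norm_num), q1 1 le_rfl] at this
    exact zero_ne_one this
  have M1 : 0 ≤ M := integral_nonneg fun x => p0 _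
  have xs : ∀ i : Fin 2, ContDiff ℝ ∞ fun x : E2 => x i := fun i => by fun_prop
  have Ks : ContDiff ℝ ∞ fun x : E2 => κ (‖x‖ ^ 2) := κs.comp ns
  refine ⟨fun x => M⁻¹ * deriv q (‖x‖ ^ 2), fun i x => M⁻¹ * (x i * κ (‖x‖ ^ 2)), ?_⟩
  refine ⟨contDiff_const.mul ρs, fun i => contDiff_const.mul ((xs i).mul Ks), fun x => ?_, ?_,
    fun x hx => ?_, fun i x hx => ?_, fun x => ?_, fun x => ?_⟩
  · exact mul_nonneg (inv_nonneg.2 M1) (p0 _)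
  · rw [integral_const_mul, ← hM, inv_mul_cancel₀ M0]
  · simp [p1 _ (sq1 x hx)]
  · simp [κ1 _ (sq1 x hx).le]
  · simp
  · have e : ∀ i : Fin 2, pd i (fun x => M⁻¹ * (x i * κ (‖x‖ ^ 2))) x =
        M⁻¹ * (x i * (deriv κ (‖x‖ ^ 2) * (2 * x i)) + κ (‖x‖ ^ 2)) := by
      intro i
      have d1 := (xs i).differentiableAt_top x
      have d2 := Ks.differentiableAt_top x
      rw [pd_const_mul _ (d1.fun_mul d2), pd_mul d1 d2, pd_comp_norm_sq κs, pd_coord]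
      simp
    have hn : ‖x‖ ^ 2 = x 0 ^ 2 + x 1 ^ 2 := by
      simpa [Fin.sum_univ_two] using EuclideanSpace.norm_sq_eq x
    have h2 : ‖(2 : ℝ) • x‖ ^ 2 = 4 * ‖x‖ ^ 2 := by
      rw [norm_smul, mul_pow]; norm_num
    rw [e, e, h2]
    have := κd (‖x‖ ^ 2)
    have h3 : ‖x‖ ^ 2 * deriv κ (‖x‖ ^ 2) = (x 0 ^ 2 + x 1 ^ 2) * deriv κ (‖x‖ ^ 2) := by
      rw [← hn]
    linear_combination 2 * M⁻¹ * (this - h3)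

lemma fderiv_eq_pd (f : E2 → ℝ) (x v : E2) :
    fderiv ℝ f x v = pd 0 f x * v 0 + pd 1 f x * v 1 := by
  have hv : v = v 0 • EuclideanSpace.single 0 (1 : ℝ) + v 1 • EuclideanSpace.single 1 (1 : ℝ) := by
    ext i; fin_cases i <;> simp
  conv_lhs => rw [hv]
  simp [pd, mul_comm]

lemma hasDerivAt_comp_curve {f : E2 → ℝ} (hf : ContDiff ℝ ∞ f) {γ : ℝ → E2} {γ' : E2} {s : ℝ}
    (hγ : HasDerivAt γ γ' s) :
    HasDerivAt (fun s => f (γ s)) (pd 0 f (γ s) * γ' 0 + pd 1 f (γ s) * γ' 1) s := by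
  rw [← fderiv_eq_pd]
  exact (hf.differentiableAt_top _).hasFDerivAt.comp_hasDerivAt s hγ

lemma hasDerivAt_coord {γ : ℝ → E2} {γ' : E2} {s : ℝ} (hγ : HasDerivAt γ γ' s) (i : Fin 2) :
    HasDerivAt (fun s => γ s i) (γ' i) s :=
  ((EuclideanSpace.proj i : E2 →L[ℝ] ℝ).hasFDerivAt.comp_hasDerivAt s hγ)

/-- The coordinates swept out by translating the curve `c` in the direction `ν`. -/
def sweep (c : ℝ → E2) (ν : E2) (p : ℝ × ℝ) : E2 := c p.1 + p.2 • ν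

lemma contDiff_sweep {c : ℝ → E2} (hc : ContDiff ℝ ∞ c) (ν : E2) : ContDiff ℝ ∞ (sweep c ν) := by
  unfold sweep; fun_prop

lemma injOn_sweep {c cd : ℝ → E2} (hcd : ∀ s, HasDerivAt c (cd s) s) {ν : E2} {a b : ℝ}
    (hJ : ∀ s ∈ Icc a b, 0 < cd s 0 * ν 1 - cd s 1 * ν 0) :
    InjOn (sweep c ν) (Icc a b ×ˢ univ) := by
  have hm : StrictMonoOn (fun s => c s 0 * ν 1 - c s 1 * ν 0) (Icc a b) := by
    have hd : ∀ s, HasDerivAt (fun s => c s 0 * ν 1 - c s 1 * ν 0)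
        (cd s 0 * ν 1 - cd s 1 * ν 0) s := fun s =>
      ((hasDerivAt_coord (hcd s) 0).mul_const _).sub ((hasDerivAt_coord (hcd s) 1).mul_const _)
    refine strictMonoOn_of_deriv_pos (convex_Icc a b)
      (fun s _ => (hd s).continuousAt.continuousWithinAt) fun s hs => ?_
    rw [(hd s).deriv]
    exact hJ s (interior_subset hs)
  rintro ⟨s, t⟩ ⟨hs, -⟩ ⟨s', t'⟩ ⟨hs', -⟩ h
  have e : ∀ i : Fin 2, c s i + t * ν i = c s' i + t' * ν i := fun i => by
    simpa [sweep] using congrArg (fun v : E2 => v i) h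
  have h1 : s = s' := hm.injOn hs hs' (by
    change c s 0 * ν 1 - c s 1 * ν 0 = c s' 0 * ν 1 - c s' 1 * ν 0
    linear_combination ν 1 * e 0 - ν 0 * e 1)
  subst h1
  have hν : ν ≠ 0 := by
    rintro rfl
    simpa using hJ s hs
  have h2 : (t - t') • ν = 0 := by
    have : c s + t • ν = c s + t' • ν := h
    rw [sub_smul, sub_eq_zero]; exact add_left_cancel this
  rcases smul_eq_zero.1 h2 with h3 | h3
  · rw [sub_eq_zero.1 h3]
  · exact absurd h3 hν

def planeEquivProd : E2 ≃ᵐ ℝ × ℝ :=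
  (MeasurableEquiv.toLp 2 (Fin 2 → ℝ)).symm.trans MeasurableEquiv.finTwoArrow

lemma planeEquivProd_apply (y : E2) : planeEquivProd y = (y 0, y 1) := rfl

lemma measurePreserving_planeEquivProd : MeasurePreserving planeEquivProd :=
  (volume_preserving_finTwoArrow ℝ).comp (PiLp.volume_preserving_ofLp (Fin 2))

lemma det_smulRight_proj (u ν : E2) :
    ((EuclideanSpace.proj 0 : E2 →L[ℝ] ℝ).smulRight u +
      (EuclideanSpace.proj 1 : E2 →L[ℝ] ℝ).smulRight ν).det = u 0 * ν 1 - u 1 * ν 0 := by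
  rw [ContinuousLinearMap.det, ← LinearMap.det_toMatrix (EuclideanSpace.basisFun (Fin 2) ℝ).toBasis,
    Matrix.det_fin_two]
  simp [LinearMap.toMatrix_apply]
  ring

lemma integral_image_sweep {c cd : ℝ → E2} (hcd : ∀ s, HasDerivAt c (cd s) s) {ν : E2} {a b : ℝ}
    (hJ : ∀ s ∈ Icc a b, 0 < cd s 0 * ν 1 - cd s 1 * ν 0) {S : Set (ℝ × ℝ)} (hS : MeasurableSet S)
    (hSab : S ⊆ Icc a b ×ˢ univ) (h : E2 → ℝ) :
    ∫ x in sweep c ν '' S, h x =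
      ∫ p in S, (cd p.1 0 * ν 1 - cd p.1 1 * ν 0) * h (sweep c ν p) := by
  have him : sweep c ν '' S =
      (fun y => sweep c ν (planeEquivProd y)) '' (planeEquivProd ⁻¹' S) := by
    rw [← image_image (sweep c ν) planeEquivProd, image_preimage_eq _ planeEquivProd.surjective]
  rw [him, integral_image_eq_integral_abs_det_fderiv_smul volume (planeEquivProd.measurable hS)
    (f' := fun y => (EuclideanSpace.proj 0 : E2 →L[ℝ] ℝ).smulRight (cd (y 0)) +
      (EuclideanSpace.proj 1 : E2 →L[ℝ] ℝ).smulRight ν)]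
  · rw [← measurePreserving_planeEquivProd.setIntegral_preimage_emb
      planeEquivProd.measurableEmbedding]
    refine setIntegral_congr_fun (planeEquivProd.measurable hS) fun y hy => ?_
    simp only [det_smulRight_proj, smul_eq_mul, planeEquivProd_apply]
    rw [abs_of_pos (hJ (y 0) (hSab hy).1)]
  · intro y _
    apply HasFDerivAt.hasFDerivWithinAt
    have h0 : ∀ i : Fin 2, HasFDerivAt (fun y : E2 => y i) (EuclideanSpace.proj i : E2 →L[ℝ] ℝ) y :=
      fun i => (EuclideanSpace.proj i : E2 →L[ℝ] ℝ).hasFDerivAt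
    refine HasFDerivAt.add (f := fun y : E2 => c (y 0)) (g := fun y : E2 => y 1 • ν) ?_ ?_
    · have := (hcd (y 0)).hasFDerivAt.comp y (h0 0)
      refine this.congr_fderiv ?_
      ext v : 1; simp
    · exact (h0 1).smul_const ν
  · intro y hy y' hy' hyy
    exact planeEquivProd.injective (injOn_sweep hcd hJ (hSab hy) (hSab hy') hyy)

lemma integral_div_image_sweep {c cd : ℝ → E2} (hcd : ∀ s, HasDerivAt c (cd s) s)
    (hc : ContDiff ℝ ∞ c) (hcs : ContDiff ℝ ∞ cd) {ν : E2} {a b a' b' : ℝ} (hab : a ≤ b)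
    (hab' : a' ≤ b') (hJ : ∀ s ∈ Icc a b, 0 < cd s 0 * ν 1 - cd s 1 * ν 0)
    {F G : E2 → ℝ} (hF : ContDiff ℝ ∞ F) (hG : ContDiff ℝ ∞ G) :
    ∫ x in sweep c ν '' (Ioo a b ×ˢ Ioo a' b'), (pd 0 F x + pd 1 G x) =
      (∫ s in a..b, (cd s 0 * G (sweep c ν (s, b')) - cd s 1 * F (sweep c ν (s, b'))))
      - (∫ s in a..b, (cd s 0 * G (sweep c ν (s, a')) - cd s 1 * F (sweep c ν (s, a'))))
      + (∫ t in a'..b', (ν 1 * F (sweep c ν (b, t)) - ν 0 * G (sweep c ν (b, t))))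
      - ∫ t in a'..b', (ν 1 * F (sweep c ν (a, t)) - ν 0 * G (sweep c ν (a, t))) := by
  have hsw := contDiff_sweep hc ν
  have hFs : ContDiff ℝ ∞ fun p => F (sweep c ν p) := hF.comp hsw
  have hGs : ContDiff ℝ ∞ fun p => G (sweep c ν p) := hG.comp hsw
  have hci : ∀ i : Fin 2, ContDiff ℝ ∞ fun p : ℝ × ℝ => cd p.1 i := fun i =>
    (by fun_prop : ContDiff ℝ ∞ fun y : E2 => y i).comp (hcs.comp contDiff_fst)
  set f : ℝ × ℝ → ℝ := fun p => ν 1 * F (sweep c ν p) - ν 0 * G (sweep c ν p) with hf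
  set g : ℝ × ℝ → ℝ := fun p => cd p.1 0 * G (sweep c ν p) - cd p.1 1 * F (sweep c ν p) with hg
  have fs : ContDiff ℝ ∞ f := (contDiff_const.mul hFs).sub (contDiff_const.mul hGs)
  have gs : ContDiff ℝ ∞ g := ((hci 0).mul hGs).sub ((hci 1).mul hFs)
  have fd : ∀ p, HasFDerivAt f (fderiv ℝ f p) p := fun p =>
    (fs.contDiffAt.differentiableAt (by simp)).hasFDerivAt
  have gd : ∀ p, HasFDerivAt g (fderiv ℝ g p) p := fun p =>
    (gs.contDiffAt.differentiableAt (by simp)).hasFDerivAt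
  have key : ∀ p, fderiv ℝ f p (1, 0) + fderiv ℝ g p (0, 1) =
      (cd p.1 0 * ν 1 - cd p.1 1 * ν 0) * (pd 0 F (sweep c ν p) + pd 1 G (sweep c ν p)) := by
    rintro ⟨s, t⟩
    have h1 : HasDerivAt (fun s => f (s, t)) (fderiv ℝ f (s, t) (1, 0)) s :=
      HasFDerivAt.comp_hasDerivAt (f := fun s => (s, t)) s (fd (s, t))
        ((hasDerivAt_id' s).prodMk (hasDerivAt_const s t))
    have h2 : HasDerivAt (fun t => g (s, t)) (fderiv ℝ g (s, t) (0, 1)) t :=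
      HasFDerivAt.comp_hasDerivAt (f := fun t => (s, t)) t (gd (s, t))
        ((hasDerivAt_const t s).prodMk (hasDerivAt_id' t))
    have k1 : HasDerivAt (fun s => sweep c ν (s, t)) (cd s) s := by
      simpa [sweep] using (hcd s).add_const (t • ν)
    have k2 : HasDerivAt (fun t => sweep c ν (s, t)) ν t := by
      simpa [sweep] using ((hasDerivAt_id t).smul_const ν).const_add (c s)
    have e1 := h1.unique (((hasDerivAt_comp_curve hF k1).const_mul (ν 1)).sub
      ((hasDerivAt_comp_curve hG k1).const_mul (ν 0)))
    have e2 := h2.unique (((hasDerivAt_comp_curve hG k2).const_mul (cd s 0)).sub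
      ((hasDerivAt_comp_curve hF k2).const_mul (cd s 1)))
    rw [e1, e2]; ring
  rw [integral_image_sweep hcd hJ (measurableSet_Ioo.prod measurableSet_Ioo)
    (prod_mono Ioo_subset_Icc_self (subset_univ _)),
    setIntegral_congr_set (t := Icc (a, a') (b, b'))]
  · have := integral_divergence_prod_Icc_of_hasFDerivAt_of_le f g (fderiv ℝ f) (fderiv ℝ g)
      (a, a') (b, b') ⟨hab, hab'⟩ fs.continuous.continuousOn gs.continuous.continuousOn
      (fun x _ => fd x) (fun x _ => gd x) (Continuous.integrableOn_Icc (by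
        exact ((fs.continuous_fderiv (by simp)).clm_apply continuous_const).add
          ((gs.continuous_fderiv (by simp)).clm_apply continuous_const)))
    simp only [key] at this
    exact this
  · rw [← Icc_prod_Icc]
    exact Measure.set_prod_ae_eq Ioo_ae_eq_Icc Ioo_ae_eq_Icc

namespace AnalyticBoundaryCurve

variable {D : Set E2} (Γ : AnalyticBoundaryCurve D)

lemma contDiff_c : ContDiff ℝ ∞ Γ.c := Γ.analytic.contDiff

lemma deriv_c : deriv Γ.c = Γ.cd := funext fun s => (Γ.hasDerivAt s).deriv

lemma contDiff_cd : ContDiff ℝ ∞ Γ.cd := by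
  rw [← Γ.deriv_c]
  exact (contDiff_infty_iff_deriv.1 Γ.contDiff_c).2

lemma continuous_c : Continuous Γ.c := Γ.contDiff_c.continuous

lemma continuous_cd_apply (i : Fin 2) : Continuous fun s => Γ.cd s i :=
  (EuclideanSpace.proj i : E2 →L[ℝ] ℝ).continuous.comp Γ.contDiff_cd.continuous

lemma periodic_cd : Function.Periodic Γ.cd Γ.len := by
  intro s
  have h : HasDerivAt (fun s => Γ.c (s + Γ.len)) (Γ.cd (s + Γ.len)) s :=
    (Γ.hasDerivAt (s + Γ.len)).comp_add_const s Γ.len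
  simp only [Γ.periodic _] at h
  exact h.unique (Γ.hasDerivAt s)

lemma cd_sq (s : ℝ) : Γ.cd s 0 ^ 2 + Γ.cd s 1 ^ 2 = 1 := by
  have := EuclideanSpace.norm_sq_eq (Γ.cd s)
  rw [Γ.unitSpeed] at this
  simpa [Fin.sum_univ_two] using this.symm

lemma injOn_Ico (a : ℝ) : InjOn Γ.c (Ico a (a + Γ.len)) := by
  intro s hs s' hs' h
  have hp := Γ.len_pos
  have hm : ∀ s, Γ.c (toIcoMod hp 0 s) = Γ.c s := fun s => by
    rw [toIcoMod]; exact Γ.periodic.sub_zsmul_eq _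
  obtain ⟨n, hn⟩ := (toIcoMod_eq_toIcoMod hp).1
    (Γ.injOn (toIcoMod_mem_Ico' hp s) (toIcoMod_mem_Ico' hp s') (by rw [hm, hm, h]))
  rw [zsmul_eq_mul] at hn
  have h1 : ((n : ℤ) : ℝ) < 1 := by
    by_contra! hc
    nlinarith [hs.1, hs.2, hs'.1, hs'.2]
  have h2 : (-1 : ℝ) < ((n : ℤ) : ℝ) := by
    by_contra! hc
    nlinarith [hs.1, hs.2, hs'.1, hs'.2]
  have h3 : n = 0 := by
    have h1' : n < 1 := by exact_mod_cast h1
    have h2' : -1 < n := by exact_mod_cast h2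
    omega
  rw [h3] at hn
  simp at hn
  linarith

lemma exists_mem_Ico {x : E2} (hx : x ∈ frontier D) (a : ℝ) :
    ∃ s ∈ Ico a (a + Γ.len), Γ.c s = x := by
  rw [← Γ.range_eq] at hx
  obtain ⟨s, rfl⟩ := hx
  exact ⟨toIcoMod Γ.len_pos a s, toIcoMod_mem_Ico _ _ _, by
    rw [toIcoMod]; exact Γ.periodic.sub_zsmul_eq _⟩

/-- The flux density of the field `(F, G)` across the curve. -/
def flux (F G : E2 → ℝ) (s : ℝ) : ℝ := F (Γ.c s) * Γ.cd s 1 - G (Γ.c s) * Γ.cd s 0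

lemma continuous_flux {F G : E2 → ℝ} (hF : Continuous F) (hG : Continuous G) :
    Continuous (Γ.flux F G) :=
  ((hF.comp Γ.continuous_c).mul (Γ.continuous_cd_apply 1)).sub
    ((hG.comp Γ.continuous_c).mul (Γ.continuous_cd_apply 0))

lemma periodic_flux (F G : E2 → ℝ) : Function.Periodic (Γ.flux F G) Γ.len := fun s => by
  simp [flux, Γ.periodic s, Γ.periodic_cd s]

lemma abs_integral_flux_le {F G : E2 → ℝ} (hF : Continuous F) (hG : Continuous G) {a b : ℝ}
    (hab : a ≤ b) (hb : b ≤ a + Γ.len) :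
    |∫ s in a..b, Γ.flux F G s| ≤ ∫ s in (0 : ℝ)..Γ.len, |Γ.flux F G s| := by
  have hc := (Γ.continuous_flux hF hG).abs
  have hp : Function.Periodic (fun s => |Γ.flux F G s|) Γ.len := fun s => by
    simp only [Γ.periodic_flux F G s]
  calc |∫ s in a..b, Γ.flux F G s| ≤ ∫ s in a..b, |Γ.flux F G s| :=
        intervalIntegral.abs_integral_le_integral_abs hab
    _ ≤ ∫ s in a..(a + Γ.len), |Γ.flux F G s| :=
        intervalIntegral.integral_mono_interval le_rfl hab hb (ae_of_all _ fun _ => abs_nonneg _)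
          (hc.intervalIntegrable _ _)
    _ = ∫ s in (0 : ℝ)..Γ.len, |Γ.flux F G s| := by
        simpa using hp.intervalIntegral_add_eq a 0

end AnalyticBoundaryCurve

lemma pd_of_notMem_tsupport {f : E2 → ℝ} {x : E2} (h : x ∉ tsupport f) (i : Fin 2) :
    pd i f x = 0 := by
  simp [pd, fderiv_of_notMem_tsupport ℝ h]

lemma map_sweep_nhds {c cd : ℝ → E2} (hcd : ∀ s, HasDerivAt c (cd s) s) (hc : ContDiff ℝ ∞ c)
    (hu : ∀ s, cd s 0 ^ 2 + cd s 1 ^ 2 = 1) (s : ℝ) :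
    map (sweep c !₂[-cd s 1, cd s 0]) (𝓝 (s, 0)) = 𝓝 (c s) := by
  set ν : E2 := !₂[-cd s 1, cd s 0] with hν
  have h1 := ((contDiff_sweep hc ν).contDiffAt (x := (s, 0))).hasStrictFDerivAt (by simp)
  have h2 : ∀ u v : ℝ, fderiv ℝ (sweep c ν) (s, 0) (u, v) = u • cd s + v • ν := by
    intro u v
    have h3 : HasDerivAt (fun r : ℝ => sweep c ν (s + r * u, r * v))
        (fderiv ℝ (sweep c ν) (s, 0) (u, v)) 0 := by
      refine HasFDerivAt.comp_hasDerivAt (f := fun r : ℝ => (s + r * u, r * v)) 0 (by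
        simpa using h1.hasFDerivAt) ?_
      refine HasDerivAt.prodMk ?_ ?_
      · simpa using ((hasDerivAt_id' (0 : ℝ)).mul_const u).const_add s
      · simpa using (hasDerivAt_id' (0 : ℝ)).mul_const v
    refine h3.unique ?_
    refine HasDerivAt.add ?_ ?_
    · have h4 : HasDerivAt (fun r : ℝ => s + r * u) u 0 := by
        simpa using ((hasDerivAt_id' (0 : ℝ)).mul_const u).const_add s
      exact HasDerivAt.scomp (𝕜 := ℝ) 0 (by simpa using hcd s) h4
    · have h5 : HasDerivAt (fun r : ℝ => r * v) v 0 := by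
        simpa using (hasDerivAt_id' (0 : ℝ)).mul_const v
      exact h5.smul_const ν
  have h6 := h1.map_nhds_eq_of_surj (by
    rw [LinearMap.range_eq_top]
    intro w
    refine ⟨(w 0 * cd s 0 + w 1 * cd s 1, -w 0 * cd s 1 + w 1 * cd s 0), ?_⟩
    have := hu s
    refine (h2 _ _).trans ?_
    ext i
    fin_cases i
    · simp [hν]; linear_combination w 0 * this
    · simp [hν]; linear_combination w 1 * this)
  simpa [sweep] using h6

lemma IsPreconnected.subset_or_disjoint_of_isOpen {X : Type*} [TopologicalSpace X] {D W : Set X}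
    (hD : IsOpen D) (hW : IsPreconnected W) (h : Disjoint W (frontier D)) :
    W ⊆ D ∨ Disjoint D W := by
  have hsub : W ⊆ D ∪ (closure D)ᶜ := by
    intro x hx
    by_cases hxD : x ∈ D
    · exact Or.inl hxD
    · refine Or.inr fun hc => disjoint_left.1 h hx ?_
      rw [hD.frontier_eq]; exact ⟨hc, hxD⟩
  rcases hW.subset_or_subset hD isClosed_closure.isOpen_compl
    (disjoint_compl_right_iff_subset.2 subset_closure) hsub with h | h
  · exact Or.inl h
  · exact Or.inr ((disjoint_compl_right_iff_subset.2 subset_closure).mono_right h)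

namespace AnalyticBoundaryCurve

variable {D : Set E2} (Γ : AnalyticBoundaryCurve D)

/-- Adapted coordinates near a boundary point: a box in which the boundary is `{t = 0}`. -/
lemma exists_box (s₀ : ℝ) :
    ∃ h > 0, h ≤ Γ.len / 2 ∧
      (∀ s ∈ Icc (s₀ - h) (s₀ + h),
        0 < Γ.cd s 0 * (!₂[-Γ.cd s₀ 1, Γ.cd s₀ 0] : E2) 1
          - Γ.cd s 1 * (!₂[-Γ.cd s₀ 1, Γ.cd s₀ 0] : E2) 0) ∧
      ∀ p ∈ Icc (s₀ - h) (s₀ + h) ×ˢ Icc (-h) h,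
        sweep Γ.c !₂[-Γ.cd s₀ 1, Γ.cd s₀ 0] p ∈ frontier D → p.2 = 0 := by
  set ν : E2 := !₂[-Γ.cd s₀ 1, Γ.cd s₀ 0] with hν
  have hL := Γ.len_pos
  have hJc : Continuous fun s => Γ.cd s 0 * ν 1 - Γ.cd s 1 * ν 0 :=
    ((Γ.continuous_cd_apply 0).mul_const _).sub ((Γ.continuous_cd_apply 1).mul_const _)
  have hJ0 : 0 < Γ.cd s₀ 0 * ν 1 - Γ.cd s₀ 1 * ν 0 := by
    have := Γ.cd_sq s₀
    simp [hν]; nlinarith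
  obtain ⟨r₀, hr₀, hJ⟩ := Metric.mem_nhds_iff.1 (hJc.continuousAt.eventually (lt_mem_nhds hJ0))
  set r := min (r₀ / 2) (Γ.len / 4) with hr
  have rp : 0 < r := by positivity
  have r1 : r ≤ r₀ / 2 := min_le_left _ _
  have r2 : r ≤ Γ.len / 4 := min_le_right _ _
  have hJr : ∀ s ∈ Icc (s₀ - r) (s₀ + r), 0 < Γ.cd s 0 * ν 1 - Γ.cd s 1 * ν 0 := fun s hs =>
    hJ (by rw [Metric.mem_ball, Real.dist_eq, abs_lt]; constructor <;> linarith [hs.1, hs.2])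
  set K := Γ.c '' Icc (s₀ + r) (s₀ + Γ.len - r) with hK
  have hKc : IsClosed K := (isCompact_Icc.image Γ.continuous_c).isClosed
  have hpK : sweep Γ.c ν (s₀, 0) ∉ K := by
    rintro ⟨s, hs, h⟩
    have : s = s₀ := Γ.injOn_Ico s₀ ⟨by linarith [hs.1], by linarith [hs.2]⟩ ⟨le_rfl, by linarith⟩
      (by simpa [sweep] using h)
    linarith [hs.1]
  obtain ⟨ε, hε, hball⟩ := Metric.mem_nhds_iff.1
    ((contDiff_sweep Γ.contDiff_c ν).continuous.continuousAt.preimage_mem_nhds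
      (hKc.isOpen_compl.mem_nhds hpK))
  refine ⟨min r (ε / 2), by positivity, (min_le_left _ _).trans (by linarith), ?_, ?_⟩
  · exact fun s hs => hJr s ⟨by linarith [hs.1, min_le_left r (ε / 2)],
      by linarith [hs.2, min_le_left r (ε / 2)]⟩
  · rintro ⟨s, t⟩ ⟨hs, ht⟩ hfr
    have m1 := min_le_left r (ε / 2)
    have m2 := min_le_right r (ε / 2)
    simp only at hs ht
    have hnK : sweep Γ.c ν (s, t) ∉ K := hball (by
      rw [Metric.mem_ball, Prod.dist_eq, max_lt_iff, Real.dist_eq, Real.dist_eq, abs_lt, abs_lt]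
      refine ⟨⟨?_, ?_⟩, ?_, ?_⟩ <;> simp only <;> linarith [hs.1, hs.2, ht.1, ht.2])
    obtain ⟨s', hs', h'⟩ := Γ.exists_mem_Ico hfr (s₀ - r)
    have hs'r : s' < s₀ + r := by
      by_contra! hc
      exact hnK (h' ▸ mem_image_of_mem _ ⟨hc, by linarith [hs'.2]⟩)
    have : ((s', 0) : ℝ × ℝ) = (s, t) :=
      injOn_sweep Γ.hasDerivAt hJr (x₁ := (s', 0)) (x₂ := (s, t)) ⟨⟨hs'.1, hs'r.le⟩, trivial⟩
        ⟨⟨by linarith [hs.1], by linarith [hs.2]⟩, trivial⟩ (by simpa [sweep] using h')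
    exact (Prod.mk.inj this).2.symm

lemma exists_nhds_abs_integral_div_le (hD : IsOpen D) {p : E2} (hp : p ∈ frontier D) :
    ∃ W ∈ 𝓝 p, ∀ F G : E2 → ℝ, ContDiff ℝ ∞ F → ContDiff ℝ ∞ G → tsupport F ⊆ W →
      tsupport G ⊆ W → |∫ x in D, (pd 0 F x + pd 1 G x)| ≤
        ∫ s in (0 : ℝ)..Γ.len, |Γ.flux F G s| := by
  obtain ⟨s₀, rfl⟩ : p ∈ range Γ.c := Γ.range_eq ▸ hp
  obtain ⟨h, hh, hhL, hJ, hbox⟩ := Γ.exists_box s₀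
  set ν : E2 := !₂[-Γ.cd s₀ 1, Γ.cd s₀ 0] with hν
  set a := s₀ - h with ha
  set b := s₀ + h with hb
  have hab : a ≤ b := by linarith
  set Φ := sweep Γ.c ν with hΦ
  have Φc : Continuous Φ := (contDiff_sweep Γ.contDiff_c ν).continuous
  have Φi : InjOn Φ (Icc a b ×ˢ univ) := injOn_sweep Γ.hasDerivAt hJ
  have subI : ∀ u v : ℝ, Ioo a b ×ˢ Ioo u v ⊆ Icc a b ×ˢ univ := fun u v =>
    prod_mono Ioo_subset_Icc_self (subset_univ _)
  set W := Φ '' (Ioo a b ×ˢ Ioo (-h) h) with hW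
  refine ⟨W, ?_, fun F G hF hG tF tG => ?_⟩
  · rw [← map_sweep_nhds Γ.hasDerivAt Γ.contDiff_c Γ.cd_sq s₀]
    refine image_mem_map (prod_mem_nhds (Ioo_mem_nhds ?_ ?_) (Ioo_mem_nhds ?_ ?_)) <;> linarith
  have z : ∀ s t, s ∈ Icc a b → (s, t) ∉ Ioo a b ×ˢ Ioo (-h) h → F (Φ (s, t)) = 0 ∧
      G (Φ (s, t)) = 0 := by
    intro s t hs hst
    have : Φ (s, t) ∉ W := by
      rintro ⟨q, hq, hqe⟩
      exact hst (Φi (subI _ _ hq) ⟨hs, trivial⟩ hqe ▸ hq)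
    exact ⟨image_eq_zero_of_notMem_tsupport fun h => this (tF h),
      image_eq_zero_of_notMem_tsupport fun h => this (tG h)⟩
  have side : ∀ s t, s ∈ Icc a b → s ∉ Ioo a b →
      ν 1 * F (Φ (s, t)) - ν 0 * G (Φ (s, t)) = 0 := by
    intro s t hs hs'
    obtain ⟨z1, z2⟩ := z s t hs fun h => hs' h.1
    rw [z1, z2]; ring
  have topbot : ∀ t, t ∉ Ioo (-h) h → ∫ s in a..b, (Γ.cd s 0 * G (Φ (s, t)) -
      Γ.cd s 1 * F (Φ (s, t))) = 0 := by
    intro t ht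
    refine (intervalIntegral.integral_congr (g := fun _ => 0) fun s hs => ?_).trans (by simp)
    rw [uIcc_of_le hab] at hs
    obtain ⟨z1, z2⟩ := z s t hs fun h => ht h.2
    simp [z1, z2]
  have mid : ∫ s in a..b, (Γ.cd s 0 * G (Φ (s, 0)) - Γ.cd s 1 * F (Φ (s, 0))) =
      -∫ s in a..b, Γ.flux F G s := by
    rw [← intervalIntegral.integral_neg]
    congr 1; ext s
    simp [hΦ, sweep, flux]; ring
  have hI : ∀ u v, u ≤ v → ∫ x in Φ '' (Ioo a b ×ˢ Ioo u v), (pd 0 F x + pd 1 G x) =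
      (∫ s in a..b, (Γ.cd s 0 * G (Φ (s, v)) - Γ.cd s 1 * F (Φ (s, v)))) -
      ∫ s in a..b, (Γ.cd s 0 * G (Φ (s, u)) - Γ.cd s 1 * F (Φ (s, u))) := by
    intro u v huv
    rw [integral_div_image_sweep Γ.hasDerivAt Γ.contDiff_c Γ.contDiff_cd hab huv hJ hF hG]
    rw [intervalIntegral.integral_congr (a := u) (g := fun _ => 0) fun t _ =>
        side b t (right_mem_Icc.2 hab) (by simp),
      intervalIntegral.integral_congr (a := u) (g := fun _ => 0) fun t _ =>
        side a t (left_mem_Icc.2 hab) (by simp)]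
    simp [hΦ]
  have hplus := hI 0 h hh.le
  have hminus := hI (-h) 0 (by linarith)
  rw [topbot h (by simp), mid] at hplus
  rw [topbot (-h) (by simp), mid] at hminus
  set X := ∫ s in a..b, Γ.flux F G s with hX
  have hXle : |X| ≤ ∫ s in (0 : ℝ)..Γ.len, |Γ.flux F G s| :=
    Γ.abs_integral_flux_le hF.continuous hG.continuous hab (by linarith)
  set Wp := Φ '' (Ioo a b ×ˢ Ioo 0 h) with hWp
  set Wm := Φ '' (Ioo a b ×ˢ Ioo (-h) 0) with hWm
  have conn : ∀ u v : ℝ, -h ≤ u → v ≤ h → (0 ∉ Ioo u v) → Φ '' (Ioo a b ×ˢ Ioo u v) ⊆ D ∨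
      Disjoint D (Φ '' (Ioo a b ×ˢ Ioo u v)) := by
    intro u v hu hv h0
    refine IsPreconnected.subset_or_disjoint_of_isOpen hD
      ((isPreconnected_Ioo.prod isPreconnected_Ioo).image _ Φc.continuousOn) ?_
    rw [disjoint_left]
    rintro _ ⟨q, hq, rfl⟩ hfr
    have := hbox q ⟨Ioo_subset_Icc_self hq.1, by linarith [hq.2.1], by linarith [hq.2.2]⟩ hfr
    exact h0 (this ▸ hq.2)
  have meas : ∀ u v : ℝ, MeasurableSet (Φ '' (Ioo a b ×ˢ Ioo u v)) := fun u v =>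
    (measurableSet_Ioo.prod measurableSet_Ioo).image_of_continuousOn_injOn Φc.continuousOn
      (Φi.mono (subI u v))
  set d : E2 → ℝ := fun x => pd 0 F x + pd 1 G x with hd
  have dc : Continuous d := (hF.pd 0).continuous.add (hG.pd 1).continuous
  have dW : ∀ x, x ∉ W → d x = 0 := fun x hx => by
    simp [hd, pd_of_notMem_tsupport (fun h => hx (tF h)),
      pd_of_notMem_tsupport (fun h => hx (tG h))]
  have dcs : HasCompactSupport d := by
    refine HasCompactSupport.of_support_subset_isCompact
      ((isCompact_Icc.prod isCompact_Icc).image Φc (s := Icc a b ×ˢ Icc (-h) h)) fun x hx => ?_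
    have : x ∈ W := by
      by_contra hc; exact hx (dW x hc)
    exact image_mono (Set.prod_mono Ioo_subset_Icc_self Ioo_subset_Icc_self) this
  have di : Integrable d := dc.integrable_of_hasCompactSupport dcs
  have hDW : ∫ x in D, d x = ∫ x in (D ∩ Wp) ∪ (D ∩ Wm), d x := by
    refine setIntegral_eq_of_subset_of_forall_sdiff_eq_zero hD.measurableSet
      (union_subset inter_subset_left inter_subset_left) fun x hx => ?_
    by_contra hne
    have hxW : x ∈ W := by
      by_contra hc; exact hne (dW x hc)
    obtain ⟨⟨s, t⟩, ⟨hs, ht⟩, rfl⟩ := hxW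
    simp only at hs ht
    rcases lt_trichotomy t 0 with h1 | h1 | h1
    · exact hx.2 (Or.inr ⟨hx.1, (s, t), ⟨hs, ht.1, h1⟩, rfl⟩)
    · subst h1
      have hfr : Φ (s, 0) ∈ frontier D := by
        rw [← Γ.range_eq]; exact ⟨s, by simp [hΦ, sweep]⟩
      rw [hD.frontier_eq] at hfr
      exact hfr.2 hx.1
    · exact hx.2 (Or.inl ⟨hx.1, (s, t), ⟨hs, h1, ht.2⟩, rfl⟩)
  have hdisj : Disjoint Wp Wm := by
    rw [disjoint_left]
    rintro _ ⟨q, hq, rfl⟩ ⟨q', hq', hqq⟩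
    have := Φi (subI _ _ hq') (subI _ _ hq) hqq
    subst this
    linarith [hq.2.1, hq'.2.2]
  rw [hDW, setIntegral_union (hdisj.mono inter_subset_right inter_subset_right)
    (hD.measurableSet.inter (meas _ _)) di.integrableOn di.integrableOn]
  have hL0 : 0 ≤ ∫ s in (0 : ℝ)..Γ.len, |Γ.flux F G s| := (abs_nonneg _).trans hXle
  rcases conn 0 h (by linarith) le_rfl (by simp) with h1 | h1 <;>
    rcases conn (-h) 0 le_rfl hh.le (by simp) with h2 | h2
  · rw [inter_eq_right.2 h1, inter_eq_right.2 h2, hplus, hminus]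
    simpa using hL0
  · rw [inter_eq_right.2 h1, disjoint_iff_inter_eq_empty.1 h2, hplus]
    simpa using hXle
  · rw [disjoint_iff_inter_eq_empty.1 h1, inter_eq_right.2 h2, hminus]
    simpa using hXle
  · rw [disjoint_iff_inter_eq_empty.1 h1, disjoint_iff_inter_eq_empty.1 h2]
    simpa using hL0

end AnalyticBoundaryCurve

lemma Continuous.integrableOn_of_isBounded {D : Set E2} (hD : Bornology.IsBounded D) {f : E2 → ℝ}
    (hf : Continuous f) : IntegrableOn f D :=
  (hf.continuousOn.integrableOn_compact hD.isCompact_closure).mono_set subset_closure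

namespace AnalyticBoundaryCurve

variable {D : Set E2} (Γ : AnalyticBoundaryCurve D)

lemma exists_nhds_abs_integral_div_le' (hD : IsPlaneDomain D) {p : E2} (hp : p ∈ closure D) :
    ∃ W ∈ 𝓝 p, ∀ F G : E2 → ℝ, ContDiff ℝ ∞ F → ContDiff ℝ ∞ G → tsupport F ⊆ W →
      tsupport G ⊆ W → |∫ x in D, (pd 0 F x + pd 1 G x)| ≤
        ∫ s in (0 : ℝ)..Γ.len, |Γ.flux F G s| := by
  by_cases hpD : p ∈ D
  · refine ⟨D, hD.isOpen.mem_nhds hpD, fun F G hF hG tF tG => ?_⟩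
    have cs : ∀ {f : E2 → ℝ}, tsupport f ⊆ D → HasCompactSupport f := fun h =>
      hD.isBounded.isCompact_closure.of_isClosed_subset (isClosed_tsupport _)
        (h.trans subset_closure)
    have h0 : ∫ x in D, (pd 0 F x + pd 1 G x) = ∫ x, (pd 0 F x + pd 1 G x) := by
      refine setIntegral_eq_integral_of_forall_compl_eq_zero fun x hx => ?_
      simp [pd_of_notMem_tsupport (fun h => hx (tF h)),
      pd_of_notMem_tsupport (fun h => hx (tG h))]
    rw [h0, integral_add ((hF.pd 0).continuous.integrable_of_hasCompactSupport ((cs tF).pd 0))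
      ((hG.pd 1).continuous.integrable_of_hasCompactSupport ((cs tG).pd 1)),
      integral_pd_eq_zero (hF.of_le (by simp)) (cs tF),
      integral_pd_eq_zero (hG.of_le (by simp)) (cs tG)]
    simpa using intervalIntegral.integral_nonneg Γ.len_pos.le fun _ _ => abs_nonneg _
  · exact Γ.exists_nhds_abs_integral_div_le hD.isOpen
      (by rw [hD.isOpen.frontier_eq]; exact ⟨hp, hpD⟩)

/-- The divergence theorem, as an inequality. -/
lemma abs_integral_div_le (hD : IsPlaneDomain D) {F G : E2 → ℝ} (hF : ContDiff ℝ ∞ F)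
    (hG : ContDiff ℝ ∞ G) :
    |∫ x in D, (pd 0 F x + pd 1 G x)| ≤ ∫ s in (0 : ℝ)..Γ.len, |Γ.flux F G s| := by
  choose! W hW h using fun (p : E2) (hp : p ∈ closure D) =>
    Γ.exists_nhds_abs_integral_div_le' hD hp
  obtain ⟨t, ht, htc⟩ := hD.isBounded.isCompact_closure.elim_nhds_subcover
    (fun p => interior (W p)) fun p hp => interior_mem_nhds.2 (hW p hp)
  obtain ⟨χ, hχ⟩ := SmoothPartitionOfUnity.exists_isSubordinate (modelWithCornersSelf ℝ E2)
    (isClosed_closure (s := D)) (fun i : t => interior (W i)) (fun _ => isOpen_interior)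
    (htc.trans (by simp [iUnion_subtype]))
  have χs : ∀ i, ContDiff ℝ ∞ (χ i) := fun i => (χ i).contMDiff.contDiff
  have χsum : ∀ x ∈ closure D, ∑ i, χ i x = 1 := fun x hx => by
    rw [← finsum_eq_sum_of_fintype]; exact χ.sum_eq_one hx
  have cut : ∀ {f : E2 → ℝ}, ContDiff ℝ ∞ f → ∀ j, ∀ x ∈ D,
      pd j f x = ∑ i, pd j (fun y => χ i y * f y) x := by
    intro f hf j x hx
    have : f =ᶠ[𝓝 x] fun y => ∑ i, χ i y * f y := by
      filter_upwards [hD.isOpen.mem_nhds hx] with y hy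
      rw [← Finset.sum_mul, χsum y (subset_closure hy), one_mul]
    rw [pd_congr this]
    simp only [pd]
    rw [fderiv_fun_sum fun i _ => ((χs i).mul hf).differentiableAt_top x]
    simp
  have smul : ∀ {f : E2 → ℝ}, ContDiff ℝ ∞ f → ∀ i, ContDiff ℝ ∞ fun y => χ i y * f y :=
    fun hf i => (χs i).mul hf
  have supp : ∀ (f : E2 → ℝ) (i : t), tsupport (fun y => χ i y * f y) ⊆ W i := fun f i =>
    (tsupport_mul_subset_left (f := χ i) (g := f)).trans ((hχ i).trans interior_subset)
  calc |∫ x in D, (pd 0 F x + pd 1 G x)|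
      = |∑ i, ∫ x in D, (pd 0 (fun y => χ i y * F y) x + pd 1 (fun y => χ i y * G y) x)| := by
        rw [← integral_finsetSum _ fun i _ => by
          exact Continuous.integrableOn_of_isBounded hD.isBounded
            (((smul hF i).pd 0).continuous.add ((smul hG i).pd 1).continuous)]
        congr 1
        refine setIntegral_congr_fun hD.isOpen.measurableSet fun x hx => ?_
        rw [cut hF 0 x hx, cut hG 1 x hx, Finset.sum_add_distrib]
    _ ≤ ∑ i, ∫ s in (0 : ℝ)..Γ.len,
          |Γ.flux (fun y => χ i y * F y) (fun y => χ i y * G y) s| :=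
        (Finset.abs_sum_le_sum_abs _ _).trans (Finset.sum_le_sum fun i _ =>
          h i (ht i i.2) _ _ (smul hF i) (smul hG i) (supp F i) (supp G i))
    _ = ∫ s in (0 : ℝ)..Γ.len, |Γ.flux F G s| := by
        rw [← intervalIntegral.integral_finsetSum fun i _ => (Γ.continuous_flux
          (smul hF i).continuous (smul hG i).continuous).abs.intervalIntegrable _ _]
        congr 1; ext s
        have hs : Γ.c s ∈ closure D := frontier_subset_closure (Γ.range_eq ▸ mem_range_self s)
        calc ∑ i, |Γ.flux (fun y => χ i y * F y) (fun y => χ i y * G y) s|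
            = ∑ i, χ i (Γ.c s) * |Γ.flux F G s| := by
              refine Finset.sum_congr rfl fun i _ => ?_
              conv_rhs => rw [← abs_of_nonneg (χ.nonneg i (Γ.c s)), ← abs_mul]
              simp only [flux]; ring_nf
          _ = |Γ.flux F G s| := by rw [← Finset.sum_mul, χsum _ hs, one_mul]

end AnalyticBoundaryCurve

/-- The convolution of the restriction of `f` to `D` with `η`. -/
def convOn (D : Set E2) (f η : E2 → ℝ) (x : E2) : ℝ := ∫ y in D, f y * η (x - y)

section convOn

variable {D : Set E2} {f η : E2 → ℝ}

lemma convOn_eq_convolution (hD : MeasurableSet D) :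
    convOn D f η = convolution (D.indicator f) η (ContinuousLinearMap.mul ℝ ℝ) volume := by
  ext x
  rw [convOn, ← integral_indicator hD, convolution_def]
  congr 1; ext y
  by_cases hy : y ∈ D <;> simp [hy]

lemma contDiff_convOn (hD : MeasurableSet D) (hf : IntegrableOn f D) (hη : ContDiff ℝ ∞ η)
    (hc : HasCompactSupport η) : ContDiff ℝ ∞ (convOn D f η) := by
  rw [convOn_eq_convolution hD]
  exact hc.contDiff_convolution_right (n := ⊤) _ (hf.integrable_indicator hD).locallyIntegrable hη

lemma pd_convOn (hD : MeasurableSet D) (hf : IntegrableOn f D) (hη : ContDiff ℝ ∞ η)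
    (hc : HasCompactSupport η) (i : Fin 2) : pd i (convOn D f η) = convOn D f (pd i η) := by
  have hl := (hf.integrable_indicator hD).locallyIntegrable
  ext x
  have h := hc.hasFDerivAt_convolution_right (ContinuousLinearMap.mul ℝ ℝ) hl
    (hη.of_le (by simp)) x
  rw [pd, convOn_eq_convolution hD, convOn_eq_convolution hD, h.fderiv,
    convolution_precompR_apply _ hl (hc.fderiv ℝ) (hη.continuous_fderiv (by simp))]
  rfl

lemma integrable_convOn_integrand (hD : MeasurableSet D) (hf : IntegrableOn f D)
    (hη : Continuous η) (hc : HasCompactSupport η) (x : E2) :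
    IntegrableOn (fun y => f y * η (x - y)) D := by
  have := hc.convolutionExists_right (ContinuousLinearMap.mul ℝ ℝ)
    (hf.integrable_indicator hD).locallyIntegrable hη x
  rw [ConvolutionExistsAt] at this
  rw [← integrable_indicator_iff hD]
  refine this.congr (ae_of_all _ fun y => ?_)
  by_cases hy : y ∈ D <;> simp [hy]

lemma lap_convOn (hD : MeasurableSet D) (hf : IntegrableOn f D) (hη : ContDiff ℝ ∞ η)
    (hc : HasCompactSupport η) (x : E2) : lap (convOn D f η) x = convOn D f (lap η) x := by
  have e : ∀ i, pd i (pd i (convOn D f η)) = convOn D f (pd i (pd i η)) := fun i => by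
    rw [pd_convOn hD hf hη hc, pd_convOn hD hf (hη.pd i) (hc.pd i)]
  rw [lap_eq, e, e]
  unfold convOn
  rw [← integral_add
    (integrable_convOn_integrand hD hf ((hη.pd 0).pd 0).continuous ((hc.pd 0).pd 0) x)
    (integrable_convOn_integrand hD hf ((hη.pd 1).pd 1).continuous ((hc.pd 1).pd 1) x)]
  simp [lap_eq, mul_add]

lemma norm_le_of_convOn_ne_zero {R r : ℝ} (hD : ∀ x ∈ D, ‖x‖ ≤ R) (hη : ∀ x, r < ‖x‖ → η x = 0)
    {x : E2} (hx : convOn D f η x ≠ 0) : ‖x‖ ≤ R + r := by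
  by_contra! h
  refine hx (setIntegral_eq_zero_of_forall_eq_zero fun y hy => ?_)
  rw [hη (x - y), mul_zero]
  have := norm_sub_norm_le x y
  linarith [hD y hy]

end convOn

lemma pd_eq_zero_of_norm {f : E2 → ℝ} {r : ℝ} (h : ∀ x, r < ‖x‖ → f x = 0) (i : Fin 2) {x : E2}
    (hx : r < ‖x‖) : pd i f x = 0 := by
  have : f =ᶠ[𝓝 x] fun _ => 0 := by
    filter_upwards [continuous_norm.continuousAt.eventually (lt_mem_nhds hx)] with y hy
      using h y hy
  rw [pd_congr this]
  simp [pd]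

lemma pd_comp_sub {f : E2 → ℝ} (hf : ContDiff ℝ ∞ f) (i : Fin 2) (x y : E2) :
    pd i (fun y => f (x - y)) y = -pd i f (x - y) := by
  have := (hf.differentiableAt_top (x - y)).hasFDerivAt.comp y ((hasFDerivAt_id y).const_sub x)
  have h2 : fderiv ℝ (fun y => f (x - y)) y = _ := this.fderiv
  simp [pd, h2]

lemma pd_comp_sub_right {f : E2 → ℝ} (hf : ContDiff ℝ ∞ f) (i : Fin 2) (x y : E2) :
    pd i (fun y => f (y - x)) y = pd i f (y - x) := by
  have := (hf.differentiableAt_top (y - x)).hasFDerivAt.comp y ((hasFDerivAt_id y).sub_const x)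
  have h2 : fderiv ℝ (fun y => f (y - x)) y = _ := this.fderiv
  simp [pd, h2]

lemma volume_norm_sub_le (y : E2) {t : ℝ} (ht : 0 < t) :
    volume {x : E2 | ‖x - y‖ ≤ t} ≤ ENNReal.ofReal (4 * t ^ 2) := by
  have : {x : E2 | ‖x - y‖ ≤ t} = Metric.closedBall y t := by
    ext x; simp [dist_eq_norm]
  rw [this, EuclideanSpace.volume_closedBall_fin_two, ← ENNReal.ofReal_pow ht.le,
    ← ENNReal.ofReal_mul (by positivity)]
  exact ENNReal.ofReal_le_ofReal (by nlinarith [Real.pi_le_four, sq_nonneg t])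

namespace AnalyticBoundaryCurve

variable {D : Set E2} (Γ : AnalyticBoundaryCurve D)

/-- The integral of `|f|` over the part of the curve within distance `t` of `x`. -/
def near (t : ℝ) (f : ℝ → ℝ) (x : E2) : ℝ :=
  ∫ s in {s | ‖x - Γ.c s‖ ≤ t}, |f s| ∂(volume.restrict (Ioc 0 Γ.len))

lemma hasStrictDerivAt (s : ℝ) : HasStrictDerivAt Γ.c (Γ.cd s) s :=
  (Γ.contDiff_c.contDiffAt (x := s)).hasStrictDerivAt' (Γ.hasDerivAt s) (by simp)

lemma exists_integral_near_sq_le :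
    ∃ A > 0, ∀ t > 0, ∀ f : ℝ → ℝ, Continuous f → Integrable (fun x => Γ.near t f x ^ 2) ∧
      ∫ x, Γ.near t f x ^ 2 ≤ A * t ^ 3 * ∫ s in (0 : ℝ)..Γ.len, f s ^ 2 := by
  obtain ⟨A, hA, h⟩ := exists_volume_closedBall_le Γ.hasStrictDerivAt
    Γ.unitSpeed (isCompact_Icc (a := (0 : ℝ)) (b := Γ.len))
  refine ⟨A * 4, by positivity, fun t ht f hf => ?_⟩
  have hS : MeasurableSet {p : E2 × ℝ | ‖p.1 - Γ.c p.2‖ ≤ t} :=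
    (isClosed_le (continuous_fst.sub (Γ.continuous_c.comp continuous_snd)).norm
      continuous_const).measurableSet
  have hSA : ∀ x, volume.restrict (Ioc 0 Γ.len) {s | ‖x - Γ.c s‖ ≤ t} ≤
      ENNReal.ofReal (A * t) := by
    intro x
    have hm : MeasurableSet {s | ‖x - Γ.c s‖ ≤ t} :=
      (isClosed_le (continuous_const.sub Γ.continuous_c).norm continuous_const).measurableSet
    rw [Measure.restrict_apply hm, inter_comm]
    exact (measure_mono (inter_subset_inter_left _ Ioc_subset_Icc_self)).trans (h x t ht)
  have hSB : ∀ s, volume {x | ‖x - Γ.c s‖ ≤ t} ≤ ENNReal.ofReal (4 * t ^ 2) := fun s =>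
    volume_norm_sub_le _ ht
  have hfi : Integrable (fun s => f s ^ 2) (volume.restrict (Ioc 0 Γ.len)) :=
    (hf.pow 2).integrableOn_Icc.mono_set Ioc_subset_Icc_self
  have key := integral_sq_setIntegral_le volume (volume.restrict (Ioc 0 Γ.len)) hS
    (A := A * t) (B := 4 * t ^ 2) (by positivity) (by positivity) hSA hSB hf.measurable hfi
  simp only [Set.mem_ofPred_eq] at key
  simp only [near]
  refine ⟨key.1, key.2.trans_eq ?_⟩
  rw [intervalIntegral.integral_of_le Γ.len_pos.le]
  ring

lemma integral_abs_le_near {t M : ℝ} {f h : ℝ → ℝ} (hf : Continuous f) {x : E2}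
    (h1 : ∀ s, ‖x - Γ.c s‖ ≤ t → |h s| ≤ M * |f s|)
    (h0 : ∀ s, t < ‖x - Γ.c s‖ → h s = 0) :
    ∫ s in (0 : ℝ)..Γ.len, |h s| ≤ M * Γ.near t f x := by
  have hm : MeasurableSet {s | ‖x - Γ.c s‖ ≤ t} :=
    (isClosed_le (continuous_const.sub Γ.continuous_c).norm continuous_const).measurableSet
  rw [intervalIntegral.integral_of_le Γ.len_pos.le, near, ← integral_const_mul,
    ← integral_indicator hm]
  refine integral_mono_of_nonneg (ae_of_all _ fun _ => abs_nonneg _) ?_ (ae_of_all _ fun s => ?_)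
  · refine Integrable.indicator ?_ hm
    exact (hf.abs.const_mul M).integrableOn_Icc.mono_set Ioc_subset_Icc_self
  · by_cases hs : ‖x - Γ.c s‖ ≤ t
    · simpa [indicator, hs] using h1 s hs
    · simp [indicator, hs, h0 s (not_le.1 hs)]

/-- The normal derivative along the curve, up to sign. -/
def normalDeriv (φ : E2 → ℝ) : ℝ → ℝ := Γ.flux (pd 0 φ) (pd 1 φ)

lemma continuous_normalDeriv {φ : E2 → ℝ} (hφ : ContDiff ℝ ∞ φ) : Continuous (Γ.normalDeriv φ) :=
  Γ.continuous_flux (hφ.pd 0).continuous (hφ.pd 1).continuous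

lemma abs_cd_le (s : ℝ) (i : Fin 2) : |Γ.cd s i| ≤ 1 := by
  have h := PiLp.norm_apply_le (Γ.cd s) i
  rwa [Γ.unitSpeed] at h

lemma abs_flux_le {F G : E2 → ℝ} {M : ℝ} {s : ℝ} (hF : |F (Γ.c s)| ≤ M) (hG : |G (Γ.c s)| ≤ M) :
    |Γ.flux F G s| ≤ 2 * M := by
  have h0 := Γ.abs_cd_le s 0
  have h1 := Γ.abs_cd_le s 1
  have hM : 0 ≤ M := (abs_nonneg _).trans hF
  calc |Γ.flux F G s| ≤ |F (Γ.c s)| * |Γ.cd s 1| + |G (Γ.c s)| * |Γ.cd s 0| := by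
        rw [← abs_mul, ← abs_mul]; exact abs_sub _ _
    _ ≤ M * 1 + M * 1 := by gcongr
    _ = 2 * M := by ring

/-- A Helmholtz solution in `D`, localised by convolution, solves the Helmholtz equation up to
boundary terms. -/
lemma abs_helmholtz_convOn_le (hD : IsPlaneDomain D) {φ η : E2 → ℝ} (hφ : ContDiff ℝ ∞ φ)
    {lam : ℝ} (hH : ∀ x ∈ D, lap φ x = -lam ^ 2 * φ x) (hη : ContDiff ℝ ∞ η) {t M₀ M₁ : ℝ}
    (hη0 : ∀ x, t < ‖x‖ → η x = 0) (hM₀ : ∀ x, |η x| ≤ M₀) (hM₁ : ∀ i x, |pd i η x| ≤ M₁)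
    (x : E2) :
    |lap (convOn D φ η) x + lam ^ 2 * convOn D φ η x| ≤
      2 * M₁ * Γ.near t (fun s => φ (Γ.c s)) x + M₀ * Γ.near t (Γ.normalDeriv φ) x := by
  have hm := hD.isOpen.measurableSet
  have hc : HasCompactSupport η := hasCompactSupport_of_norm hη0
  have hi : IntegrableOn φ D := hφ.continuous.integrableOn_of_isBounded hD.isBounded
  have hηp : ∀ i x, t < ‖x‖ → pd i η x = 0 := fun i x hx => pd_eq_zero_of_norm hη0 i hx
  set ζ : E2 → ℝ := fun y => η (x - y) with hζ
  have ζs : ContDiff ℝ ∞ ζ := hη.comp (contDiff_const.sub contDiff_id)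
  have ζ1 : ∀ i y, pd i ζ y = -pd i η (x - y) := fun i y => pd_comp_sub hη i x y
  have ζ2 : ∀ i y, pd i (pd i ζ) y = pd i (pd i η) (x - y) := by
    intro i y
    have h1 : pd i ζ = fun y => -1 * pd i η (x - y) := by
      ext y; rw [ζ1]; ring
    have h3 : ContDiff ℝ ∞ fun y => pd i η (x - y) :=
      (hη.pd i).comp (contDiff_const.sub contDiff_id)
    rw [h1, pd_const_mul _ (h3.differentiableAt_top y), pd_comp_sub (hη.pd i)]
    ring
  set F : Fin 2 → E2 → ℝ := fun i y => φ y * pd i ζ y - ζ y * pd i φ y with hF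
  have Fs : ∀ i, ContDiff ℝ ∞ (F i) := fun i => (hφ.mul (ζs.pd i)).sub (ζs.mul (hφ.pd i))
  have hdiv : ∀ y ∈ D, pd 0 (F 0) y + pd 1 (F 1) y =
      φ y * lap η (x - y) + lam ^ 2 * (φ y * η (x - y)) := by
    intro y hy
    have e : ∀ i, pd i (F i) y = φ y * pd i (pd i ζ) y - ζ y * pd i (pd i φ) y := by
      intro i
      have d1 := hφ.differentiableAt_top y
      have d2 := ζs.differentiableAt_top y
      have d3 := (hφ.pd i).differentiableAt_top y
      have d4 := (ζs.pd i).differentiableAt_top y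
      rw [hF, pd_sub (d1.fun_mul d4) (d2.fun_mul d3), pd_mul d1 d4, pd_mul d2 d3]
      ring
    have h := hH y hy
    rw [lap_eq] at h
    rw [e, e, lap_eq, ζ2, ζ2]
    linear_combination -ζ y * h
  have lapc : Continuous (lap η) := by
    rw [funext (lap_eq η)]; exact ((hη.pd 0).pd 0).continuous.add ((hη.pd 1).pd 1).continuous
  have laph : HasCompactSupport (lap η) := by
    rw [funext (lap_eq η)]; exact ((hc.pd 0).pd 0).add ((hc.pd 1).pd 1)
  have hg : lap (convOn D φ η) x + lam ^ 2 * convOn D φ η x =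
      ∫ y in D, (pd 0 (F 0) y + pd 1 (F 1) y) := by
    rw [lap_convOn hm hi hη hc, setIntegral_congr_fun hD.isOpen.measurableSet hdiv, integral_add
      (integrable_convOn_integrand hm hi lapc laph x)
      ((integrable_convOn_integrand hm hi hη.continuous hc x).const_mul _), integral_const_mul]
    rfl
  have hflux : ∀ s, Γ.flux (F 0) (F 1) s =
      φ (Γ.c s) * Γ.flux (pd 0 ζ) (pd 1 ζ) s - ζ (Γ.c s) * Γ.normalDeriv φ s := by
    intro s; simp only [flux, normalDeriv, hF]; ring
  have cφ : Continuous fun s => φ (Γ.c s) := hφ.continuous.comp Γ.continuous_c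
  have cζ : Continuous fun s => ζ (Γ.c s) := ζs.continuous.comp Γ.continuous_c
  have cf := Γ.continuous_flux (ζs.pd 0).continuous (ζs.pd 1).continuous
  have cn := Γ.continuous_normalDeriv hφ
  rw [hg]
  refine (Γ.abs_integral_div_le hD (Fs 0) (Fs 1)).trans ?_
  calc ∫ s in (0 : ℝ)..Γ.len, |Γ.flux (F 0) (F 1) s|
      ≤ ∫ s in (0 : ℝ)..Γ.len, (|φ (Γ.c s) * Γ.flux (pd 0 ζ) (pd 1 ζ) s| +
          |ζ (Γ.c s) * Γ.normalDeriv φ s|) := by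
        refine intervalIntegral.integral_mono_on Γ.len_pos.le
          ((Γ.continuous_flux (Fs 0).continuous (Fs 1).continuous).abs.intervalIntegrable _ _)
          (((cφ.mul cf).abs.add (cζ.mul cn).abs).intervalIntegrable _ _) fun s _ => ?_
        rw [hflux]; exact abs_sub _ _
    _ = (∫ s in (0 : ℝ)..Γ.len, |φ (Γ.c s) * Γ.flux (pd 0 ζ) (pd 1 ζ) s|) +
          ∫ s in (0 : ℝ)..Γ.len, |ζ (Γ.c s) * Γ.normalDeriv φ s| :=
        intervalIntegral.integral_add ((cφ.mul cf).abs.intervalIntegrable _ _)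
          ((cζ.mul cn).abs.intervalIntegrable _ _)
    _ ≤ _ := by
        refine add_le_add (Γ.integral_abs_le_near cφ (fun s _ => ?_) fun s hs => ?_)
          (Γ.integral_abs_le_near cn (fun s _ => ?_) fun s hs => ?_)
        · rw [abs_mul, mul_comm]
          refine mul_le_mul_of_nonneg_right (Γ.abs_flux_le ?_ ?_) (abs_nonneg _) <;>
          · rw [ζ1, abs_neg]; exact hM₁ _ _
        · simp [flux, ζ1, hηp _ _ hs]
        · rw [abs_mul]
          exact mul_le_mul_of_nonneg_right (hM₀ _) (abs_nonneg _)
        · simp [hζ, hη0 _ hs]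

end AnalyticBoundaryCurve

/-- The rescaling of a mollifier on the unit disc to the disc of radius `t`. -/
def mollify (ρ : E2 → ℝ) (t : ℝ) (x : E2) : ℝ := t⁻¹ ^ 2 * ρ (t⁻¹ • x)

lemma exists_abs_le_of_eq_zero {f : E2 → ℝ} (hf : Continuous f) (h : ∀ x, 1 < ‖x‖ → f x = 0) :
    ∃ M > 0, ∀ x, |f x| ≤ M := by
  obtain ⟨M, hM⟩ := (hasCompactSupport_of_norm h).exists_bound_of_continuous hf
  exact ⟨max M 1, by positivity, fun x => (hM x).trans (le_max_left _ _)⟩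

lemma comp_inv_smul_eq_zero {f : E2 → ℝ} (h : ∀ x, 1 < ‖x‖ → f x = 0) {t : ℝ} (ht : 0 < t)
    {x : E2} (hx : t < ‖x‖) : f (t⁻¹ • x) = 0 := by
  refine h _ ?_
  rw [norm_smul, norm_inv, Real.norm_of_nonneg ht.le, inv_mul_eq_div]
  exact (one_lt_div ht).2 hx

lemma contDiff_mollify {ρ : E2 → ℝ} (hρ : ContDiff ℝ ∞ ρ) (t : ℝ) : ContDiff ℝ ∞ (mollify ρ t) :=
  contDiff_const.mul (hρ.comp (contDiff_const_smul _))

lemma pd_mollify {ρ : E2 → ℝ} (hρ : ContDiff ℝ ∞ ρ) (t : ℝ) (i : Fin 2) (x : E2) :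
    pd i (mollify ρ t) x = t⁻¹ ^ 3 * pd i ρ (t⁻¹ • x) := by
  have h : ContDiff ℝ ∞ fun x => ρ (t⁻¹ • x) := hρ.comp (contDiff_const_smul _)
  unfold mollify
  rw [pd_const_mul _ (h.differentiableAt_top x), pd_comp_smul hρ]
  ring

namespace AnalyticBoundaryCurve

variable {D : Set E2} (Γ : AnalyticBoundaryCurve D)

lemma exists_integral_helmholtz_convOn_sq_le (hD : IsPlaneDomain D) {ρ : E2 → ℝ}
    {K : Fin 2 → E2 → ℝ} (hρ : IsMollifierPair ρ K) :
    ∃ A > 0, ∀ t > 0, ∀ (lam : ℝ) (φ : E2 → ℝ), ContDiff ℝ ∞ φ →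
      (∀ x ∈ D, lap φ x = -lam ^ 2 * φ x) →
      ∫ x, (lap (convOn D φ (mollify ρ t)) x + lam ^ 2 * convOn D φ (mollify ρ t) x) ^ 2 ≤
        A * (t⁻¹ ^ 3 * (∫ s in (0 : ℝ)..Γ.len, φ (Γ.c s) ^ 2) +
          t⁻¹ * ∫ s in (0 : ℝ)..Γ.len, Γ.normalDeriv φ s ^ 2) := by
  obtain ⟨A, hA, hnear⟩ := Γ.exists_integral_near_sq_le
  obtain ⟨M₀, hM₀, h0⟩ := exists_abs_le_of_eq_zero hρ.contDiff.continuous hρ.eq_zero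
  obtain ⟨M₁, hM₁, h1⟩ := exists_abs_le_of_eq_zero (hρ.contDiff.pd 0).continuous
    fun x hx => pd_eq_zero_of_norm hρ.eq_zero 0 hx
  obtain ⟨M₂, hM₂, h2⟩ := exists_abs_le_of_eq_zero (hρ.contDiff.pd 1).continuous
    fun x hx => pd_eq_zero_of_norm hρ.eq_zero 1 hx
  refine ⟨(8 * (M₁ + M₂) ^ 2 + 2 * M₀ ^ 2) * A, by positivity, fun t ht lam φ hφ hH => ?_⟩
  have hti : 0 < t⁻¹ := inv_pos.2 ht
  have hp := fun x => Γ.abs_helmholtz_convOn_le hD hφ hH (contDiff_mollify hρ.contDiff t) (t := t)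
    (M₀ := t⁻¹ ^ 2 * M₀) (M₁ := t⁻¹ ^ 3 * (M₁ + M₂))
    (fun x hx => by rw [mollify, comp_inv_smul_eq_zero hρ.eq_zero ht hx, mul_zero])
    (fun x => by
      rw [mollify, abs_mul, abs_of_pos (by positivity : 0 < t⁻¹ ^ 2)]
      exact mul_le_mul_of_nonneg_left (h0 _) (by positivity))
    (fun i x => by
      rw [pd_mollify hρ.contDiff, abs_mul, abs_of_pos (by positivity : 0 < t⁻¹ ^ 3)]
      refine mul_le_mul_of_nonneg_left ?_ (by positivity)
      fin_cases i
      · exact (h1 _).trans (by linarith)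
      · exact (h2 _).trans (by linarith)) x
  obtain ⟨i1, n1⟩ := hnear t ht _ (hφ.continuous.comp Γ.continuous_c)
  obtain ⟨i2, n2⟩ := hnear t ht _ (Γ.continuous_normalDeriv hφ)
  have c1 : 0 ≤ 2 * (2 * (t⁻¹ ^ 3 * (M₁ + M₂))) ^ 2 := by positivity
  have c2 : 0 ≤ 2 * (t⁻¹ ^ 2 * M₀) ^ 2 := by positivity
  have e1 : 0 ≤ ∫ s in (0 : ℝ)..Γ.len, φ (Γ.c s) ^ 2 :=
    intervalIntegral.integral_nonneg Γ.len_pos.le fun _ _ => sq_nonneg _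
  have e2 : 0 ≤ ∫ s in (0 : ℝ)..Γ.len, Γ.normalDeriv φ s ^ 2 :=
    intervalIntegral.integral_nonneg Γ.len_pos.le fun _ _ => sq_nonneg _
  calc _ ≤ ∫ x, (2 * (2 * (t⁻¹ ^ 3 * (M₁ + M₂))) ^ 2 * Γ.near t (φ ∘ Γ.c) x ^ 2 +
          2 * (t⁻¹ ^ 2 * M₀) ^ 2 * Γ.near t (Γ.normalDeriv φ) x ^ 2) := by
        refine integral_mono_of_nonneg (ae_of_all _ fun _ => sq_nonneg _)
          ((i1.const_mul _).add (i2.const_mul _)) (ae_of_all _ fun x => ?_)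
        refine (sq_le_sq' (neg_le_of_abs_le (hp x)) (le_of_abs_le (hp x))).trans ?_
        refine (add_sq_le).trans_eq ?_
        simp only [Function.comp_def]; ring
    _ = 2 * (2 * (t⁻¹ ^ 3 * (M₁ + M₂))) ^ 2 * (∫ x, Γ.near t (φ ∘ Γ.c) x ^ 2) +
          2 * (t⁻¹ ^ 2 * M₀) ^ 2 * ∫ x, Γ.near t (Γ.normalDeriv φ) x ^ 2 := by
        rw [integral_add (i1.const_mul _) (i2.const_mul _), integral_const_mul, integral_const_mul]
    _ ≤ 2 * (2 * (t⁻¹ ^ 3 * (M₁ + M₂))) ^ 2 *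
            (A * t ^ 3 * ∫ s in (0 : ℝ)..Γ.len, φ (Γ.c s) ^ 2) +
          2 * (t⁻¹ ^ 2 * M₀) ^ 2 *
            (A * t ^ 3 * ∫ s in (0 : ℝ)..Γ.len, Γ.normalDeriv φ s ^ 2) :=
        add_le_add (mul_le_mul_of_nonneg_left n1 c1) (mul_le_mul_of_nonneg_left n2 c2)
    _ = 8 * (M₁ + M₂) ^ 2 * A * (t⁻¹ ^ 3 * ∫ s in (0 : ℝ)..Γ.len, φ (Γ.c s) ^ 2) +
          2 * M₀ ^ 2 * A * (t⁻¹ * ∫ s in (0 : ℝ)..Γ.len, Γ.normalDeriv φ s ^ 2) := by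
        field_simp; ring
    _ ≤ _ := by
        have a1 : 0 ≤ t⁻¹ ^ 3 * ∫ s in (0 : ℝ)..Γ.len, φ (Γ.c s) ^ 2 := by positivity
        have a2 : 0 ≤ t⁻¹ * ∫ s in (0 : ℝ)..Γ.len, Γ.normalDeriv φ s ^ 2 := by positivity
        have b1 := mul_nonneg (by positivity : 0 ≤ 2 * M₀ ^ 2 * A) a1
        have b2 := mul_nonneg (by positivity : 0 ≤ 8 * (M₁ + M₂) ^ 2 * A) a2
        linarith

lemma exists_integral_convOn_sq_le (hD : IsPlaneDomain D) {ρ : E2 → ℝ}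
    {K : Fin 2 → E2 → ℝ} (hρ : IsMollifierPair ρ K) :
    ∃ A > 0, ∀ t > 0, t ≤ 1 → ∀ (lam : ℝ) (φ : E2 → ℝ), 1 ≤ lam → ContDiff ℝ ∞ φ →
      (∀ x ∈ D, lap φ x = -lam ^ 2 * φ x) →
      ∫ x in D, convOn D φ (mollify ρ t) x ^ 2 ≤
        A / lam ^ 2 * (t⁻¹ ^ 3 * (∫ s in (0 : ℝ)..Γ.len, φ (Γ.c s) ^ 2) +
          t⁻¹ * ∫ s in (0 : ℝ)..Γ.len, Γ.normalDeriv φ s ^ 2) := by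
  obtain ⟨A, hA, h⟩ := Γ.exists_integral_helmholtz_convOn_sq_le hD hρ
  obtain ⟨R, hR⟩ := hD.isBounded.exists_norm_le
  refine ⟨2 * (1 + (R + 1) ^ 2) * A, by positivity, fun t ht ht1 lam φ hlam hφ hH => ?_⟩
  have hm := hD.isOpen.measurableSet
  have z : ∀ x, t < ‖x‖ → mollify ρ t x = 0 := fun x hx => by
    rw [mollify, comp_inv_smul_eq_zero hρ.eq_zero ht hx, mul_zero]
  have hi : IntegrableOn φ D := hφ.continuous.integrableOn_of_isBounded hD.isBounded
  have hv := contDiff_convOn hm hi (contDiff_mollify hρ.contDiff t) (hasCompactSupport_of_norm z)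
  have hn : ∀ x, convOn D φ (mollify ρ t) x ≠ 0 → ‖x‖ ≤ R + 1 := fun x hx =>
    (norm_le_of_convOn_ne_zero hR z hx).trans (by linarith)
  have hg := h t ht lam φ hφ hH
  revert hv hn hg
  generalize convOn D φ (mollify ρ t) = v
  intro hv hn hg
  have hc : HasCompactSupport v := hasCompactSupport_of_norm (r := R + 1) fun x hx => by
    by_contra hx'
    exact absurd (hn x hx') (not_le.2 hx)
  have hv2 : Integrable fun x => v x ^ 2 := by
    simp only [pow_two]
    exact (hv.continuous.mul hv.continuous).integrable_of_hasCompactSupport hc.mul_right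
  calc ∫ x in D, v x ^ 2 ≤ ∫ x, v x ^ 2 :=
        setIntegral_le_integral hv2 (ae_of_all _ fun _ => sq_nonneg _)
    _ ≤ 2 * (1 + (R + 1) ^ 2) / lam ^ 2 * ∫ x, (lap v x + lam ^ 2 * v x) ^ 2 :=
        integral_sq_le_of_helmholtz hv hc hlam hn
    _ ≤ _ := mul_le_mul_of_nonneg_left hg (by positivity)
    _ = _ := by ring

end AnalyticBoundaryCurve

/-- If consecutive terms of a bounded sequence get close in `L²` at a geometric rate, the first
term is close to the limit. -/
lemma integral_sub_sq_le_of_tendsto {α : Type*} [MeasurableSpace α] {μ : Measure α}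
    [IsFiniteMeasure μ] {u : ℕ → α → ℝ} {f : α → ℝ} {B M : ℝ}
    (hu : ∀ n, AEStronglyMeasurable (u n) μ) (hM : ∀ n, ∀ᵐ x ∂μ, |u n x| ≤ M)
    (hd : ∀ n, ∫ x, (u n x - u (n + 1) x) ^ 2 ∂μ ≤ B * (1 / 2) ^ n)
    (hlim : ∀ᵐ x ∂μ, Tendsto (fun n => u n x) atTop (𝓝 (f x))) :
    ∫ x, (u 0 x - f x) ^ 2 ∂μ ≤ 12 * B := by
  have hb : ∀ m n, ∀ᵐ x ∂μ, ‖(u m x - u n x) ^ 2‖ ≤ (2 * M) ^ 2 := by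
    intro m n
    filter_upwards [hM m, hM n] with x h1 h2
    rw [norm_pow, Real.norm_eq_abs]
    refine pow_le_pow_left₀ (abs_nonneg _) ?_ 2
    exact (abs_sub _ _).trans (by linarith)
  have hm : ∀ m n, AEStronglyMeasurable (fun x => (u m x - u n x) ^ 2) μ := fun m n =>
    ((hu m).sub (hu n)).pow 2
  have hi : ∀ m n, Integrable (fun x => (u m x - u n x) ^ 2) μ := fun m n =>
    Integrable.of_bound (hm m n) _ (hb m n)
  have hD : ∀ N m, ∫ x, (u m x - u (m + N) x) ^ 2 ∂μ ≤ 12 * (B * (1 / 2) ^ m) := by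
    intro N
    induction N with
    | zero =>
      intro m
      have := (integral_nonneg fun x => sq_nonneg (u m x - u (m + 1) x)).trans (hd m)
      simpa using this
    | succ N ih =>
      intro m
      have h1 := hd m
      have h2 := ih (m + 1)
      calc ∫ x, (u m x - u (m + (N + 1)) x) ^ 2 ∂μ
          ≤ ∫ x, (3 * (u m x - u (m + 1) x) ^ 2 +
              3 / 2 * (u (m + 1) x - u (m + 1 + N) x) ^ 2) ∂μ := by
            refine integral_mono (hi _ _) (((hi _ _).const_mul _).add ((hi _ _).const_mul _))
              fun x => ?_
            rw [add_right_comm m 1 N, add_assoc m N 1]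
            simp only
            nlinarith [sq_nonneg (2 * (u m x - u (m + 1) x) -
              (u (m + 1) x - u (m + (N + 1)) x))]
        _ = 3 * (∫ x, (u m x - u (m + 1) x) ^ 2 ∂μ) +
              3 / 2 * ∫ x, (u (m + 1) x - u (m + 1 + N) x) ^ 2 ∂μ := by
            rw [integral_add ((hi _ _).const_mul _) ((hi _ _).const_mul _), integral_const_mul,
              integral_const_mul]
        _ ≤ 3 * (B * (1 / 2) ^ m) + 3 / 2 * (12 * (B * (1 / 2) ^ (m + 1))) := by gcongr
        _ = 12 * (B * (1 / 2) ^ m) := by ring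
  have ht : Tendsto (fun N => ∫ x, (u 0 x - u N x) ^ 2 ∂μ) atTop
      (𝓝 (∫ x, (u 0 x - f x) ^ 2 ∂μ)) := by
    refine tendsto_integral_of_dominated_convergence (fun _ => (2 * M) ^ 2) (fun n => hm 0 n)
      (integrable_const _) (fun n => hb 0 n) ?_
    filter_upwards [hlim] with x hx
    exact (hx.const_sub _).pow 2
  refine le_of_tendsto' ht fun N => ?_
  simpa using hD N 0

lemma mollify_nonneg {ρ : E2 → ℝ} (h : ∀ x, 0 ≤ ρ x) (t : ℝ) (x : E2) : 0 ≤ mollify ρ t x :=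
  mul_nonneg (by positivity) (h _)

lemma integral_mollify {ρ : E2 → ℝ} (h : ∫ x, ρ x = 1) {t : ℝ} (ht : 0 < t) :
    ∫ x, mollify ρ t x = 1 := by
  unfold mollify
  rw [integral_const_mul, Measure.integral_comp_inv_smul_of_nonneg _ _ ht.le, h,
    finrank_euclideanSpace_fin]
  simp [ht.ne']

lemma abs_convOn_mollify_le {D : Set E2} (hD : IsPlaneDomain D) {ρ : E2 → ℝ}
    {K : Fin 2 → E2 → ℝ} (hρ : IsMollifierPair ρ K) {t M : ℝ} (ht : 0 < t) {φ : E2 → ℝ}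
    (hM : ∀ x ∈ D, |φ x| ≤ M) (x : E2) : |convOn D φ (mollify ρ t) x| ≤ M := by
  obtain ⟨x₀, hx₀⟩ := hD.isConnected.nonempty
  have hM0 : 0 ≤ M := (abs_nonneg _).trans (hM x₀ hx₀)
  have hz : ∀ x, t < ‖x‖ → mollify ρ t x = 0 := fun x hx => by
    rw [mollify, comp_inv_smul_eq_zero hρ.eq_zero ht hx, mul_zero]
  have hi : Integrable (mollify ρ t) :=
    (contDiff_mollify hρ.contDiff t).continuous.integrable_of_hasCompactSupport
      (hasCompactSupport_of_norm hz)
  have hi' : Integrable fun y => M * mollify ρ t (x - y) := (hi.comp_sub_left x).const_mul M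
  calc |convOn D φ (mollify ρ t) x| ≤ ∫ y in D, |φ y * mollify ρ t (x - y)| :=
        abs_integral_le_integral_abs
    _ ≤ ∫ y in D, M * mollify ρ t (x - y) := by
        refine integral_mono_of_nonneg (ae_of_all _ fun _ => abs_nonneg _) hi'.integrableOn ?_
        filter_upwards [ae_restrict_mem hD.isOpen.measurableSet] with y hy
        rw [abs_mul, abs_of_nonneg (mollify_nonneg hρ.nonneg _ _)]
        exact mul_le_mul_of_nonneg_right (hM y hy) (mollify_nonneg hρ.nonneg _ _)
    _ ≤ ∫ y, M * mollify ρ t (x - y) := setIntegral_le_integral hi'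
        (ae_of_all _ fun y => mul_nonneg hM0 (mollify_nonneg hρ.nonneg _ _))
    _ = M := by
        rw [integral_const_mul, integral_sub_left_eq_self (mollify ρ t) volume x,
          integral_mollify hρ.integral_eq_one ht, mul_one]

lemma tendsto_convOn_mollify {D : Set E2} (hD : IsPlaneDomain D) {ρ : E2 → ℝ}
    {K : Fin 2 → E2 → ℝ} (hρ : IsMollifierPair ρ K) {φ : E2 → ℝ} (hφ : Continuous φ)
    {x : E2} (hx : x ∈ D) {t : ℝ} (ht : 0 < t) :
    Tendsto (fun n : ℕ => convOn D φ (mollify ρ (t / 2 ^ n)) x) atTop (𝓝 (φ x)) := by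
  have hm := hD.isOpen.measurableSet
  have hg : Integrable (D.indicator φ) :=
    (integrable_indicator_iff hm).2 (hφ.integrableOn_of_isBounded hD.isBounded)
  have hev : D.indicator φ =ᶠ[𝓝 x] φ := by
    filter_upwards [hD.isOpen.mem_nhds hx] with y hy using indicator_of_mem hy _
  have hdecay : Tendsto (fun x => ‖x‖ ^ Module.finrank ℝ E2 * ρ x) (Bornology.cobounded E2)
      (𝓝 0) := by
    refine tendsto_const_nhds.congr' ?_
    filter_upwards [tendsto_norm_cobounded_atTop.eventually (eventually_gt_atTop 1)] with y hy
    rw [hρ.eq_zero y hy, mul_zero]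
  have h := tendsto_integral_comp_smul_smul_of_integrable' hρ.nonneg hρ.integral_eq_one hdecay hg
    (x₀ := x) (hφ.continuousAt.congr hev.symm)
  rw [indicator_of_mem hx] at h
  have hs : Tendsto (fun n : ℕ => (t / 2 ^ n)⁻¹) atTop atTop := by
    simp only [inv_div]
    exact (tendsto_pow_atTop_atTop_of_one_lt (by norm_num)).atTop_div_const ht
  refine (h.comp hs).congr fun n => ?_
  rw [convOn, ← integral_indicator hm, finrank_euclideanSpace_fin]
  refine integral_congr_ae (ae_of_all _ fun y => ?_)
  by_cases hy : y ∈ D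
  · simp only [hy, indicator_of_mem, mollify, smul_eq_mul]; ring
  · simp [hy]

/-- The integral of `|f|` over the part of `D` within distance `t` of `x`. -/
def nearOn (D : Set E2) (t : ℝ) (f : E2 → ℝ) (x : E2) : ℝ :=
  ∫ y in {y | ‖x - y‖ ≤ t}, |f y| ∂(volume.restrict D)

lemma measurableSet_norm_sub_le (x : E2) (t : ℝ) : MeasurableSet {y : E2 | ‖x - y‖ ≤ t} :=
  (isClosed_le (continuous_const.sub continuous_id).norm continuous_const).measurableSet

lemma integral_nearOn_sq_le {D : Set E2} (hD : IsPlaneDomain D) {t : ℝ} (ht : 0 < t) {f : E2 → ℝ}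
    (hf : Continuous f) : Integrable (fun x => nearOn D t f x ^ 2) ∧
      ∫ x, nearOn D t f x ^ 2 ≤ 16 * t ^ 4 * ∫ y in D, f y ^ 2 := by
  have hfin : IsFiniteMeasure (volume.restrict D) :=
    ⟨by simpa using hD.isBounded.measure_lt_top⟩
  have hS : MeasurableSet {p : E2 × E2 | ‖p.1 - p.2‖ ≤ t} :=
    (isClosed_le (continuous_fst.sub continuous_snd).norm continuous_const).measurableSet
  have hSA : ∀ x : E2, volume.restrict D {y | ‖x - y‖ ≤ t} ≤ ENNReal.ofReal (4 * t ^ 2) := by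
    intro x
    refine (Measure.restrict_apply_le _ _).trans ?_
    simp only [norm_sub_rev x]
    exact volume_norm_sub_le x ht
  have key := integral_sq_setIntegral_le volume (volume.restrict D) hS
    (A := 4 * t ^ 2) (B := 4 * t ^ 2) (by positivity) (by positivity) hSA
    (fun y => volume_norm_sub_le y ht) hf.measurable
    ((hf.pow 2).integrableOn_of_isBounded hD.isBounded)
  simp only [Set.mem_ofPred_eq] at key
  simp only [nearOn]
  exact ⟨key.1, key.2.trans_eq (by ring)⟩

lemma abs_setIntegral_mul_le_nearOn {D : Set E2} (hD : IsPlaneDomain D) {t M : ℝ} {f η : E2 → ℝ}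
    (hf : Continuous f) {x : E2} (h1 : ∀ y, |η y| ≤ M) (h0 : ∀ y, t < ‖x - y‖ → η y = 0) :
    |∫ y in D, f y * η y| ≤ M * nearOn D t f x := by
  have hm := measurableSet_norm_sub_le x t
  refine abs_integral_le_integral_abs.trans ?_
  rw [nearOn, ← integral_const_mul, ← integral_indicator hm]
  refine integral_mono_of_nonneg (ae_of_all _ fun _ => abs_nonneg _) ?_ (ae_of_all _ fun y => ?_)
  · exact ((hf.abs.const_mul M).integrableOn_of_isBounded hD.isBounded).indicator hm
  · by_cases hs : ‖x - y‖ ≤ t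
    · simp only [indicator, mem_ofPred_eq, hs, if_true, abs_mul]
      rw [mul_comm]
      exact mul_le_mul_of_nonneg_right (h1 y) (abs_nonneg _)
    · simp [indicator, hs, h0 y (not_le.1 hs)]

namespace AnalyticBoundaryCurve

variable {D : Set E2} (Γ : AnalyticBoundaryCurve D)

lemma abs_convOn_mollify_sub_half_le (hD : IsPlaneDomain D) {ρ : E2 → ℝ} {K : Fin 2 → E2 → ℝ}
    (hρ : IsMollifierPair ρ K) {M : ℝ} (hM : ∀ i x, |K i x| ≤ M) {t : ℝ} (ht : 0 < t)
    {φ : E2 → ℝ} (hφ : ContDiff ℝ ∞ φ) (x : E2) :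
    |convOn D φ (mollify ρ t) x - convOn D φ (mollify ρ (t / 2)) x| ≤
      t⁻¹ * M * nearOn D t (pd 0 φ) x + t⁻¹ * M * nearOn D t (pd 1 φ) x +
        2 * (t⁻¹ * M) * Γ.near t (fun s => φ (Γ.c s)) x := by
  have hti : 0 < t⁻¹ := inv_pos.2 ht
  have hm := hD.isOpen.measurableSet
  have hi : IntegrableOn φ D := hφ.continuous.integrableOn_of_isBounded hD.isBounded
  set κ : Fin 2 → E2 → ℝ := fun i y => t⁻¹ * K i (t⁻¹ • (y - x)) with hκ
  have κs : ∀ i, ContDiff ℝ ∞ (κ i) := fun i =>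
    contDiff_const.mul ((hρ.contDiff_field i).comp
      ((contDiff_const_smul _).comp (contDiff_id.sub contDiff_const)))
  have κb : ∀ i y, |κ i y| ≤ t⁻¹ * M := fun i y => by
    rw [hκ]; simp only [abs_mul, abs_of_pos hti]
    exact mul_le_mul_of_nonneg_left (hM _ _) hti.le
  have κ0 : ∀ i y, t < ‖x - y‖ → κ i y = 0 := fun i y hy => by
    rw [norm_sub_rev] at hy
    simp only [hκ, comp_inv_smul_eq_zero (hρ.field_eq_zero i) ht hy, mul_zero]
  have κd : ∀ i y, pd i (κ i) y = t⁻¹ ^ 2 * pd i (K i) (t⁻¹ • (y - x)) := fun i y => by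
    have h : ContDiff ℝ ∞ fun z => K i (t⁻¹ • z) :=
      (hρ.contDiff_field i).comp (contDiff_const_smul _)
    have h' : ContDiff ℝ ∞ fun y => K i (t⁻¹ • (y - x)) :=
      h.comp (contDiff_id.sub contDiff_const)
    rw [hκ, pd_const_mul _ (h'.differentiableAt_top y), pd_comp_sub_right h,
      pd_comp_smul (hρ.contDiff_field i)]
    ring
  have z : ∀ t > 0, HasCompactSupport (mollify ρ t) := fun t ht =>
    hasCompactSupport_of_norm (r := t) fun x hx => by
      rw [mollify, comp_inv_smul_eq_zero hρ.eq_zero ht hx, mul_zero]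
  have Fs : ∀ i, ContDiff ℝ ∞ fun y => φ y * κ i y := fun i => hφ.mul (κs i)
  have c : ∀ i, Continuous fun y => pd i φ y * κ i y := fun i =>
    (hφ.pd i).continuous.mul (κs i).continuous
  have hpt : ∀ y, φ y * mollify ρ t (x - y) - φ y * mollify ρ (t / 2) (x - y) =
      pd 0 (fun y => φ y * κ 0 y) y + pd 1 (fun y => φ y * κ 1 y) y -
        (pd 0 φ y * κ 0 y + pd 1 φ y * κ 1 y) := by
    intro y
    rw [pd_mul (hφ.differentiableAt_top y) ((κs 0).differentiableAt_top y),
      pd_mul (hφ.differentiableAt_top y) ((κs 1).differentiableAt_top y), κd, κd]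
    have hd := hρ.div_field (t⁻¹ • (y - x))
    have e1 : ρ (t⁻¹ • (x - y)) = ρ (t⁻¹ • (y - x)) := by
      rw [← hρ.even, ← smul_neg, neg_sub]
    have e2 : ρ ((t / 2)⁻¹ • (x - y)) = ρ ((2 : ℝ) • t⁻¹ • (y - x)) := by
      rw [← hρ.even, ← smul_neg, neg_sub, smul_smul]
      congr 2; field_simp
    have e3 : (t / 2)⁻¹ ^ 2 = 4 * t⁻¹ ^ 2 := by field_simp; norm_num
    rw [mollify, mollify, e1, e2, e3]
    linear_combination -(φ y * t⁻¹ ^ 2) * hd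
  have hflux : ∀ s, Γ.flux (fun y => φ y * κ 0 y) (fun y => φ y * κ 1 y) s =
      φ (Γ.c s) * Γ.flux (κ 0) (κ 1) s := by
    intro s; simp only [flux]; ring
  have hA := Γ.abs_integral_div_le hD (Fs 0) (Fs 1)
  have hB : ∫ s in (0 : ℝ)..Γ.len, |Γ.flux (fun y => φ y * κ 0 y) (fun y => φ y * κ 1 y) s| ≤
      2 * (t⁻¹ * M) * Γ.near t (fun s => φ (Γ.c s)) x := by
    refine Γ.integral_abs_le_near (hφ.continuous.comp Γ.continuous_c) (fun s _ => ?_)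
      fun s hs => ?_
    · rw [hflux, abs_mul, mul_comm]
      exact mul_le_mul_of_nonneg_right (Γ.abs_flux_le (κb _ _) (κb _ _)) (abs_nonneg _)
    · simp [flux, κ0 _ _ hs]
  have h0 := abs_setIntegral_mul_le_nearOn hD (hφ.pd 0).continuous (κb 0) (κ0 0)
  have h1 := abs_setIntegral_mul_le_nearOn hD (hφ.pd 1).continuous (κb 1) (κ0 1)
  have I : ∀ {f : E2 → ℝ}, Continuous f → IntegrableOn f D := fun hf =>
    hf.integrableOn_of_isBounded hD.isBounded
  have hdiff : convOn D φ (mollify ρ t) x - convOn D φ (mollify ρ (t / 2)) x =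
      (∫ y in D, (pd 0 (fun y => φ y * κ 0 y) y + pd 1 (fun y => φ y * κ 1 y) y)) -
        ((∫ y in D, pd 0 φ y * κ 0 y) + ∫ y in D, pd 1 φ y * κ 1 y) := by
    have c1 : Continuous fun y => pd 0 (fun y => φ y * κ 0 y) y + pd 1 (fun y => φ y * κ 1 y) y :=
      ((Fs 0).pd 0).continuous.add ((Fs 1).pd 1).continuous
    have c2 : Continuous fun y => pd 0 φ y * κ 0 y + pd 1 φ y * κ 1 y := (c 0).add (c 1)
    rw [← integral_add (I (c 0)) (I (c 1)), ← integral_sub (I c1) (I c2), convOn, convOn,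
      ← integral_sub
        (integrable_convOn_integrand hm hi (contDiff_mollify hρ.contDiff t).continuous (z t ht) x)
        (integrable_convOn_integrand hm hi (contDiff_mollify hρ.contDiff _).continuous
          (z (t / 2) (by positivity)) x)]
    exact integral_congr_ae (ae_of_all _ hpt)
  rw [hdiff]
  refine (abs_sub _ _).trans ?_
  have := abs_add_le (∫ y in D, pd 0 φ y * κ 0 y) (∫ y in D, pd 1 φ y * κ 1 y)
  linarith

lemma exists_integral_convOn_mollify_sub_half_sq_le (hD : IsPlaneDomain D) {ρ : E2 → ℝ}
    {K : Fin 2 → E2 → ℝ} (hρ : IsMollifierPair ρ K) :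
    ∃ A > 0, ∀ t > 0, ∀ φ : E2 → ℝ, ContDiff ℝ ∞ φ →
      ∫ x in D, (convOn D φ (mollify ρ t) x - convOn D φ (mollify ρ (t / 2)) x) ^ 2 ≤
        A * (t ^ 2 * (∫ x in D, (pd 0 φ x ^ 2 + pd 1 φ x ^ 2)) +
          t * ∫ s in (0 : ℝ)..Γ.len, φ (Γ.c s) ^ 2) := by
  obtain ⟨A, hA, hnear⟩ := Γ.exists_integral_near_sq_le
  obtain ⟨M₀, hM₀, h0⟩ := exists_abs_le_of_eq_zero (hρ.contDiff_field 0).continuous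
    (hρ.field_eq_zero 0)
  obtain ⟨M₁, hM₁, h1⟩ := exists_abs_le_of_eq_zero (hρ.contDiff_field 1).continuous
    (hρ.field_eq_zero 1)
  obtain ⟨M, hM, hK⟩ : ∃ M > 0, ∀ i x, |K i x| ≤ M := by
    refine ⟨M₀ + M₁, by positivity, fun i x => ?_⟩
    fin_cases i
    · exact (h0 _).trans (by linarith)
    · exact (h1 _).trans (by linarith)
  refine ⟨3 * M ^ 2 * (16 + 4 * A), by positivity, fun t ht φ hφ => ?_⟩
  obtain ⟨i0, n0⟩ := integral_nearOn_sq_le hD ht (hφ.pd 0).continuous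
  obtain ⟨i1, n1⟩ := integral_nearOn_sq_le hD ht (hφ.pd 1).continuous
  obtain ⟨i2, n2⟩ := hnear t ht _ (hφ.continuous.comp Γ.continuous_c)
  have hp := fun x => Γ.abs_convOn_mollify_sub_half_le hD hρ hK ht hφ x
  set G := ∫ x in D, (pd 0 φ x ^ 2 + pd 1 φ x ^ 2) with hG
  set a := ∫ s in (0 : ℝ)..Γ.len, φ (Γ.c s) ^ 2 with ha
  have hGs : G = (∫ x in D, pd 0 φ x ^ 2) + ∫ x in D, pd 1 φ x ^ 2 :=
    integral_add (((hφ.pd 0).continuous.pow 2).integrableOn_of_isBounded hD.isBounded)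
      (((hφ.pd 1).continuous.pow 2).integrableOn_of_isBounded hD.isBounded)
  have hG0 : 0 ≤ G := integral_nonneg fun x => by positivity
  have ha0 : 0 ≤ a := intervalIntegral.integral_nonneg Γ.len_pos.le fun _ _ => sq_nonneg _
  set k := t⁻¹ * M with hk
  have hk0 : 0 ≤ 3 * k ^ 2 := by positivity
  have i01 : Integrable fun x => nearOn D t (pd 0 φ) x ^ 2 + nearOn D t (pd 1 φ) x ^ 2 := i0.add i1
  have I' : Integrable fun x => 3 * k ^ 2 * (nearOn D t (pd 0 φ) x ^ 2 +
      nearOn D t (pd 1 φ) x ^ 2 + 4 * Γ.near t (φ ∘ Γ.c) x ^ 2) :=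
    (i01.add (i2.const_mul 4)).const_mul _
  calc _ ≤ ∫ x in D, 3 * k ^ 2 * (nearOn D t (pd 0 φ) x ^ 2 + nearOn D t (pd 1 φ) x ^ 2 +
          4 * Γ.near t (φ ∘ Γ.c) x ^ 2) := by
        refine integral_mono_of_nonneg (ae_of_all _ fun _ => sq_nonneg _) I'.integrableOn
          (ae_of_all _ fun x => ?_)
        refine (sq_le_sq' (neg_le_of_abs_le (hp x)) (le_of_abs_le (hp x))).trans ?_
        simp only [Function.comp_def]
        generalize nearOn D t (pd 0 φ) x = u
        generalize nearOn D t (pd 1 φ) x = v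
        generalize Γ.near t (fun s => φ (Γ.c s)) x = w
        have : 0 ≤ k ^ 2 * ((u - v) ^ 2 + (u - 2 * w) ^ 2 + (v - 2 * w) ^ 2) := by positivity
        linarith
    _ ≤ ∫ x, 3 * k ^ 2 * (nearOn D t (pd 0 φ) x ^ 2 + nearOn D t (pd 1 φ) x ^ 2 +
          4 * Γ.near t (φ ∘ Γ.c) x ^ 2) :=
        setIntegral_le_integral I' (ae_of_all _ fun x => by positivity)
    _ = 3 * k ^ 2 * ((∫ x, nearOn D t (pd 0 φ) x ^ 2) + (∫ x, nearOn D t (pd 1 φ) x ^ 2) +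
          4 * ∫ x, Γ.near t (φ ∘ Γ.c) x ^ 2) := by
        rw [integral_const_mul, integral_add i01 (i2.const_mul 4), integral_const_mul,
          integral_add i0 i1]
    _ ≤ 3 * k ^ 2 * (16 * t ^ 4 * (∫ x in D, pd 0 φ x ^ 2) +
          16 * t ^ 4 * (∫ x in D, pd 1 φ x ^ 2) + 4 * (A * t ^ 3 * a)) := by
        refine mul_le_mul_of_nonneg_left ?_ hk0
        gcongr
        exact n2
    _ = 3 * M ^ 2 * (16 * (t ^ 2 * G) + 4 * A * (t * a)) := by
        rw [hGs, hk]; field_simp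
    _ ≤ _ := by
        have b1 : 0 ≤ 3 * M ^ 2 * (4 * A * (t ^ 2 * G) + 16 * (t * a)) := by positivity
        linarith

lemma exists_integral_convOn_mollify_sub_sq_le (hD : IsPlaneDomain D) {ρ : E2 → ℝ}
    {K : Fin 2 → E2 → ℝ} (hρ : IsMollifierPair ρ K) :
    ∃ A > 0, ∀ t > 0, ∀ φ : E2 → ℝ, ContDiff ℝ ∞ φ →
      ∫ x in D, (convOn D φ (mollify ρ t) x - φ x) ^ 2 ≤
        A * (t ^ 2 * (∫ x in D, (pd 0 φ x ^ 2 + pd 1 φ x ^ 2)) +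
          t * ∫ s in (0 : ℝ)..Γ.len, φ (Γ.c s) ^ 2) := by
  obtain ⟨A, hA, h⟩ := Γ.exists_integral_convOn_mollify_sub_half_sq_le hD hρ
  refine ⟨12 * A, by positivity, fun t ht φ hφ => ?_⟩
  have hfin : IsFiniteMeasure (volume.restrict D) :=
    ⟨by simpa using hD.isBounded.measure_lt_top⟩
  have hm := hD.isOpen.measurableSet
  have hi : IntegrableOn φ D := hφ.continuous.integrableOn_of_isBounded hD.isBounded
  obtain ⟨M, hM⟩ := hD.isBounded.isCompact_closure.exists_bound_of_continuousOn
    hφ.continuous.continuousOn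
  have hM' : ∀ x ∈ D, |φ x| ≤ M := fun x hx => hM x (subset_closure hx)
  have ht' : ∀ n : ℕ, 0 < t / 2 ^ n := fun n => by positivity
  set G := ∫ x in D, (pd 0 φ x ^ 2 + pd 1 φ x ^ 2) with hG
  set a := ∫ s in (0 : ℝ)..Γ.len, φ (Γ.c s) ^ 2 with ha
  have hG0 : 0 ≤ G := integral_nonneg fun x => by positivity
  have ha0 : 0 ≤ a := intervalIntegral.integral_nonneg Γ.len_pos.le fun _ _ => sq_nonneg _
  have key := integral_sub_sq_le_of_tendsto (μ := volume.restrict D)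
    (u := fun n => convOn D φ (mollify ρ (t / 2 ^ n))) (f := φ) (M := M)
    (B := A * (t ^ 2 * G + t * a)) (fun n => ?_)
    (fun n => ae_of_all _ fun x => abs_convOn_mollify_le hD hρ (ht' n) hM' x) (fun n => ?_) ?_
  · simpa [mul_assoc] using key
  · refine (contDiff_convOn hm hi (contDiff_mollify hρ.contDiff _)
      ?_).continuous.aestronglyMeasurable
    exact hasCompactSupport_of_norm (r := t / 2 ^ n) fun x hx => by
      rw [mollify, comp_inv_smul_eq_zero hρ.eq_zero (ht' n) hx, mul_zero]
  · have := h _ (ht' n) φ hφ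
    rw [div_div, ← pow_succ] at this
    refine this.trans ?_
    rw [mul_assoc]
    refine mul_le_mul_of_nonneg_left ?_ hA.le
    have e : t / 2 ^ n = t * (1 / 2) ^ n := by rw [one_div, inv_pow]; rfl
    have q0 : 0 ≤ (1 / 2 : ℝ) ^ n := by positivity
    have q1 : (1 / 2 : ℝ) ^ n ≤ 1 := pow_le_one₀ (by norm_num) (by norm_num)
    rw [e, ← hG, ← ha]
    generalize (1 / 2 : ℝ) ^ n = q at *
    have : 0 ≤ t ^ 2 * G * (q * (1 - q)) :=
      mul_nonneg (by positivity) (mul_nonneg q0 (by linarith))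
    linarith
  · filter_upwards [ae_restrict_mem hm] with x hx
    exact tendsto_convOn_mollify hD hρ hφ.continuous hx ht

/-- The energy inequality. -/
lemma integral_gradient_sq_le (hD : IsPlaneDomain D) {φ : E2 → ℝ} (hφ : ContDiff ℝ ∞ φ) {lam : ℝ}
    (hH : ∀ x ∈ D, lap φ x = -lam ^ 2 * φ x) :
    ∫ x in D, (pd 0 φ x ^ 2 + pd 1 φ x ^ 2) ≤ lam ^ 2 * (∫ x in D, φ x ^ 2) +
      ((∫ s in (0 : ℝ)..Γ.len, φ (Γ.c s) ^ 2) +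
        ∫ s in (0 : ℝ)..Γ.len, Γ.normalDeriv φ s ^ 2) / 2 := by
  have I : ∀ {f : E2 → ℝ}, Continuous f → IntegrableOn f D := fun hf =>
    hf.integrableOn_of_isBounded hD.isBounded
  have c1 : Continuous fun x => pd 0 φ x ^ 2 + pd 1 φ x ^ 2 :=
    ((hφ.pd 0).continuous.pow 2).add ((hφ.pd 1).continuous.pow 2)
  have c2 : Continuous fun x => lam ^ 2 * φ x ^ 2 := (hφ.continuous.pow 2).const_mul _
  have e : ∫ x in D, (pd 0 (fun x => φ x * pd 0 φ x) x + pd 1 (fun x => φ x * pd 1 φ x) x) =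
      (∫ x in D, (pd 0 φ x ^ 2 + pd 1 φ x ^ 2)) - lam ^ 2 * ∫ x in D, φ x ^ 2 := by
    rw [← integral_const_mul, ← integral_sub (I c1) (I c2)]
    refine setIntegral_congr_fun hD.isOpen.measurableSet fun x hx => ?_
    have h := hH x hx
    rw [lap_eq] at h
    rw [pd_mul (hφ.differentiableAt_top x) ((hφ.pd 0).differentiableAt_top x),
      pd_mul (hφ.differentiableAt_top x) ((hφ.pd 1).differentiableAt_top x)]
    linear_combination φ x * h
  have hA := Γ.abs_integral_div_le hD (hφ.mul (hφ.pd 0)) (hφ.mul (hφ.pd 1))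
  have cφ : Continuous fun s => φ (Γ.c s) := hφ.continuous.comp Γ.continuous_c
  have cn := Γ.continuous_normalDeriv hφ
  have hf : ∀ s, Γ.flux (fun x => φ x * pd 0 φ x) (fun x => φ x * pd 1 φ x) s =
      φ (Γ.c s) * Γ.normalDeriv φ s := fun s => by simp only [flux, normalDeriv]; ring
  have hB : ∫ s in (0 : ℝ)..Γ.len,
      |Γ.flux (fun x => φ x * pd 0 φ x) (fun x => φ x * pd 1 φ x) s| ≤
      ((∫ s in (0 : ℝ)..Γ.len, φ (Γ.c s) ^ 2) +
        ∫ s in (0 : ℝ)..Γ.len, Γ.normalDeriv φ s ^ 2) / 2 := by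
    have c3 : Continuous fun s => φ (Γ.c s) ^ 2 := cφ.pow 2
    have c4 : Continuous fun s => Γ.normalDeriv φ s ^ 2 := cn.pow 2
    rw [← intervalIntegral.integral_add (c3.intervalIntegrable _ _) (c4.intervalIntegrable _ _),
      ← intervalIntegral.integral_div]
    refine intervalIntegral.integral_mono_on Γ.len_pos.le ?_ ?_ fun s _ => ?_
    · simp only [hf]
      exact (cφ.mul cn).abs.intervalIntegrable _ _
    · exact ((c3.add c4).div_const 2).intervalIntegrable _ _
    · rw [hf, abs_mul, ← sq_abs (φ _), ← sq_abs (Γ.normalDeriv φ s)]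
      nlinarith [sq_nonneg (|φ (Γ.c s)| - |Γ.normalDeriv φ s|)]
  rw [e] at hA
  linarith [le_abs_self ((∫ x in D, (pd 0 φ x ^ 2 + pd 1 φ x ^ 2)) - lam ^ 2 * ∫ x in D, φ x ^ 2)]

lemma exists_integral_sq_le_of_contDiff (hD : IsPlaneDomain D) :
    ∃ C > 0, ∀ lam : ℝ, 1 ≤ lam → ∀ φ : E2 → ℝ, ContDiff ℝ ∞ φ →
      (∀ x ∈ D, lap φ x = -lam ^ 2 * φ x) →
      ∫ x in D, φ x ^ 2 ≤ C * lam * ((∫ s in (0 : ℝ)..Γ.len, φ (Γ.c s) ^ 2) +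
        ∫ s in (0 : ℝ)..Γ.len, Γ.normalDeriv φ s ^ 2) := by
  obtain ⟨ρ, K, hρ⟩ := exists_isMollifierPair
  obtain ⟨A₁, hA₁, hv⟩ := Γ.exists_integral_convOn_sq_le hD hρ
  obtain ⟨A₂, hA₂, hw⟩ := Γ.exists_integral_convOn_mollify_sub_sq_le hD hρ
  obtain ⟨δ, hδ, hδ1, hδA⟩ : ∃ δ > 0, δ ≤ 1 ∧ 4 * (A₂ * δ ^ 2) ≤ 1 := by
    refine ⟨1 / (2 * (1 + A₂)), by positivity, ?_, ?_⟩
    · rw [div_le_one (by positivity)]; linarith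
    · rw [one_div, inv_pow, ← mul_assoc, ← div_eq_mul_inv, div_le_one (by positivity)]
      nlinarith
  refine ⟨4 * A₁ * δ⁻¹ ^ 3 + 8 * A₂, by positivity, fun lam hlam φ hφ hH => ?_⟩
  have hl : 0 < lam := by linarith
  have ht1 : δ / lam ≤ 1 := (div_le_one hl).2 (hδ1.trans hlam)
  have hv := hv (δ / lam) (by positivity) ht1 lam φ hlam hφ hH
  have hw := hw (δ / lam) (by positivity) φ hφ
  have hG := Γ.integral_gradient_sq_le hD hφ hH
  have hm := hD.isOpen.measurableSet
  have hc : Continuous (convOn D φ (mollify ρ (δ / lam))) := by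
    refine (contDiff_convOn hm (hφ.continuous.integrableOn_of_isBounded hD.isBounded)
      (contDiff_mollify hρ.contDiff _) ?_).continuous
    exact hasCompactSupport_of_norm (r := δ / lam) fun x hx => by
      rw [mollify, comp_inv_smul_eq_zero hρ.eq_zero (by positivity) hx, mul_zero]
  have ha0 : 0 ≤ ∫ s in (0 : ℝ)..Γ.len, φ (Γ.c s) ^ 2 :=
    intervalIntegral.integral_nonneg Γ.len_pos.le fun _ _ => sq_nonneg _
  have hb0 : 0 ≤ ∫ s in (0 : ℝ)..Γ.len, Γ.normalDeriv φ s ^ 2 :=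
    intervalIntegral.integral_nonneg Γ.len_pos.le fun _ _ => sq_nonneg _
  generalize (∫ s in (0 : ℝ)..Γ.len, φ (Γ.c s) ^ 2) = a at *
  generalize (∫ s in (0 : ℝ)..Γ.len, Γ.normalDeriv φ s ^ 2) = b at *
  generalize (∫ x in D, (pd 0 φ x ^ 2 + pd 1 φ x ^ 2)) = G at *
  generalize convOn D φ (mollify ρ (δ / lam)) = v at *
  have c1 : Continuous fun x => 2 * v x ^ 2 := (hc.pow 2).const_mul _
  have c2 : Continuous fun x => 2 * (v x - φ x) ^ 2 := ((hc.sub hφ.continuous).pow 2).const_mul _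
  have hsplit : ∫ x in D, φ x ^ 2 ≤
      2 * (∫ x in D, v x ^ 2) + 2 * ∫ x in D, (v x - φ x) ^ 2 := by
    rw [← integral_const_mul, ← integral_const_mul, ← integral_add
      (c1.integrableOn_of_isBounded hD.isBounded) (c2.integrableOn_of_isBounded hD.isBounded)]
    refine integral_mono ((hφ.continuous.pow 2).integrableOn_of_isBounded hD.isBounded)
      ((c1.add c2).integrableOn_of_isBounded hD.isBounded) fun x => ?_
    simp only
    nlinarith [sq_nonneg (2 * v x - φ x)]
  have hv' : ∫ x in D, v x ^ 2 ≤ A₁ * δ⁻¹ ^ 3 * lam * (a + b) := by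
    have hδi : 1 ≤ δ⁻¹ := (one_le_inv₀ hδ).2 hδ1
    have h1 : lam⁻¹ * δ⁻¹ ≤ lam * δ⁻¹ ^ 3 := by
      have : lam⁻¹ ≤ lam := (inv_le_one_of_one_le₀ hlam).trans hlam
      have h2 : δ⁻¹ ≤ δ⁻¹ ^ 3 := le_self_pow₀ hδi (by norm_num)
      gcongr
    refine hv.trans ?_
    calc _ = A₁ * (lam * δ⁻¹ ^ 3 * a + lam⁻¹ * δ⁻¹ * b) := by field_simp
      _ ≤ A₁ * (lam * δ⁻¹ ^ 3 * a + lam * δ⁻¹ ^ 3 * b) := by gcongr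
      _ = _ := by ring
  have hw' : ∫ x in D, (v x - φ x) ^ 2 ≤
      A₂ * δ ^ 2 * (∫ x in D, φ x ^ 2) + 2 * A₂ * lam * (a + b) := by
    refine hw.trans ?_
    calc _ ≤ A₂ * ((δ / lam) ^ 2 * (lam ^ 2 * (∫ x in D, φ x ^ 2) + (a + b) / 2) +
            1 * (a + b)) := by gcongr; linarith
      _ = A₂ * δ ^ 2 * (∫ x in D, φ x ^ 2) + A₂ * ((δ / lam) ^ 2 * ((a + b) / 2) + (a + b)) := by
          field_simp; ring
      _ ≤ A₂ * δ ^ 2 * (∫ x in D, φ x ^ 2) +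
            A₂ * (1 ^ 2 * (lam * (a + b)) + lam * (a + b)) := by
          have : a + b ≤ lam * (a + b) := le_mul_of_one_le_left (by positivity) hlam
          have : (a + b) / 2 ≤ lam * (a + b) := by linarith
          gcongr
      _ = _ := by ring
  have hP : 0 ≤ ∫ x in D, φ x ^ 2 := integral_nonneg fun _ => sq_nonneg _
  have := mul_le_mul_of_nonneg_right hδA hP
  linarith

end AnalyticBoundaryCurve

lemma exists_contDiff_eventuallyEq {s U : Set E2} (hs : IsClosed s) (hU : IsOpen U) (hsU : s ⊆ U)
    {φ : E2 → ℝ} (hφ : ContDiffOn ℝ ∞ φ U) :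
    ∃ ψ : E2 → ℝ, ContDiff ℝ ∞ ψ ∧ ∀ x ∈ s, ψ =ᶠ[𝓝 x] φ := by
  obtain ⟨V, hV, hsV, hVU⟩ := normal_exists_closure_subset hs hU hsU
  obtain ⟨χ, h1, h0, -⟩ := exists_contMDiffMap_one_nhds_of_subset_interior
    (n := ⊤) (modelWithCornersSelf ℝ E2) hs (hsV.trans hV.interior_eq.ge)
  refine ⟨fun x => χ x * φ x, contDiff_iff_contDiffAt.2 fun x => ?_, fun x hx => ?_⟩
  · by_cases hx : x ∈ U
    · exact χ.contMDiff.contDiff.contDiffAt.mul (hφ.contDiffAt (hU.mem_nhds hx))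
    · refine contDiffAt_const (c := (0 : ℝ)) |>.congr_of_eventuallyEq ?_
      filter_upwards [isClosed_closure.isOpen_compl.mem_nhds fun h => hx (hVU h)] with y hy
      rw [h0 y fun h => hy (subset_closure h), zero_mul]
  · filter_upwards [h1.filter_mono (nhds_le_nhdsSet hx)] with y hy
    rw [hy, one_mul]

lemma lap_congr {f g : E2 → ℝ} {x : E2} (h : f =ᶠ[𝓝 x] g) : lap f x = lap g x := by
  have hp : ∀ i, pd i f =ᶠ[𝓝 x] pd i g := fun i => by
    filter_upwards [eventually_eventually_nhds.2 h] with y hy using pd_congr hy i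
  rw [lap_eq, lap_eq, pd_congr (hp 0), pd_congr (hp 1)]

lemma AnalyticBoundaryCurve.inner_gradient_sq {D : Set E2} (Γ : AnalyticBoundaryCurve D)
    (φ : E2 → ℝ) (s : ℝ) : (⟪gradient φ (Γ.c s), Γ.n s⟫ : ℝ) ^ 2 = Γ.normalDeriv φ s ^ 2 := by
  have h1 : Γ.n s 0 ^ 2 + Γ.n s 1 ^ 2 = 1 := by
    have := Γ.n_unit s
    rw [EuclideanSpace.norm_eq, Real.sqrt_eq_one] at this
    simpa [Fin.sum_univ_two] using this
  have h2 : Γ.n s 0 * Γ.cd s 0 + Γ.n s 1 * Γ.cd s 1 = 0 := by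
    have := Γ.n_orth s
    simp only [PiLp.inner_apply, Fin.sum_univ_two] at this
    simp at this
    linarith
  have h3 := Γ.cd_sq s
  have hg : ∀ i, pd i φ (Γ.c s) = gradient φ (Γ.c s) i := fun i => by
    have h := InnerProductSpace.toDual_symm_apply (𝕜 := ℝ) (y := fderiv ℝ φ (Γ.c s))
      (x := EuclideanSpace.single i (1 : ℝ))
    rw [← gradient, EuclideanSpace.inner_single_right] at h
    simpa [pd] using h.symm
  have hi : (⟪gradient φ (Γ.c s), Γ.n s⟫ : ℝ) =
      gradient φ (Γ.c s) 0 * Γ.n s 0 + gradient φ (Γ.c s) 1 * Γ.n s 1 := by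
    simp only [PiLp.inner_apply, Fin.sum_univ_two]
    simp [mul_comm]
  rw [hi, normalDeriv, flux, hg, hg]
  generalize gradient φ (Γ.c s) 0 = p
  generalize gradient φ (Γ.c s) 1 = q
  generalize Γ.n s 0 = m at *
  generalize Γ.n s 1 = n at *
  generalize Γ.cd s 0 = a at *
  generalize Γ.cd s 1 = b at *
  have e1 : m = (m * b - n * a) * b := by linear_combination a * h2 - m * h3
  have e2 : n = -((m * b - n * a) * a) := by linear_combination b * h2 - n * h3
  have e3 : (m * b - n * a) ^ 2 = 1 := by
    linear_combination h1 * (a ^ 2 + b ^ 2) + h3 - (m * a + n * b) * h2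
  calc (p * m + q * n) ^ 2 = (m * b - n * a) ^ 2 * (p * b - q * a) ^ 2 := by
        have e4 : p * m + q * n = (m * b - n * a) * (p * b - q * a) := by
          linear_combination p * e1 + q * e2
        rw [e4, mul_pow]
    _ = _ := by rw [e3, one_mul]

/-- The `L²` norm of a Helmholtz solution on `D` is controlled, up to a factor `Cλ`, by the
`L²` norms of its Cauchy data along the boundary curve of `D`. -/
theorem interior_L2_controlled_by_cauchy_data
    (D : Set E2) (hD : IsPlaneDomain D) (Γ : AnalyticBoundaryCurve D) :
    ∃ C > (0 : ℝ), ∃ lam₀ > (0 : ℝ), ∀ lam : ℝ, lam₀ ≤ lam → ∀ φ : E2 → ℝ,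
      (∃ U : Set E2, IsOpen U ∧ closure D ⊆ U ∧ ContDiffOn ℝ (⊤ : ℕ∞) φ U ∧
        ∀ x ∈ U, lap φ x = -lam ^ 2 * φ x) →
      (∫ x in D, (φ x) ^ 2) ≤
        C * lam * ((∫ s in (0 : ℝ)..Γ.len, (φ (Γ.c s)) ^ 2) +
          ∫ s in (0 : ℝ)..Γ.len, (⟪gradient φ (Γ.c s), Γ.n s⟫ : ℝ) ^ 2) := by
  obtain ⟨C, hC, h⟩ := Γ.exists_integral_sq_le_of_contDiff hD
  refine ⟨C, hC, 1, one_pos, fun lam hlam φ ⟨U, hU, hDU, hφ, hH⟩ => ?_⟩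
  obtain ⟨ψ, hψ, hψφ⟩ := exists_contDiff_eventuallyEq isClosed_closure hU hDU hφ
  have key := h lam hlam ψ hψ fun x hx => by
    have hx' := subset_closure hx
    rw [lap_congr (hψφ x hx'), (hψφ x hx').eq_of_nhds, hH x (hDU hx')]
  have hΓ : ∀ s, Γ.c s ∈ closure D := fun s =>
    frontier_subset_closure (Γ.range_eq ▸ mem_range_self s)
  rw [setIntegral_congr_fun hD.isOpen.measurableSet fun x hx => by
    rw [(hψφ x (subset_closure hx)).eq_of_nhds]] at key
  have hc : ∀ s, ψ (Γ.c s) = φ (Γ.c s) := fun s => (hψφ _ (hΓ s)).eq_of_nhds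
  have hn : ∀ s, Γ.normalDeriv ψ s = Γ.normalDeriv φ s := fun s => by
    simp only [AnalyticBoundaryCurve.normalDeriv, AnalyticBoundaryCurve.flux,
      fun i => pd_congr (hψφ _ (hΓ s)) i]
  simpa only [Γ.inner_gradient_sq, hc, hn] using key
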